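/- The embedding of PRED2₀ into I₀ is complete: if ⟦Δ⟧ ∪ Γ(Δ ∪ {φ}) ⊢ ⟦φ⟧ in I₀ (Δ a set of PRED2₀ formulas, φ a PRED2₀ formula) then Δ ⊢ φ in PRED2₀. -/

import Mathlib

/-! Infrastructure: type-free λ-terms over a set of constants, βη-conversion,
and the illative systems Iω, Iω^c and I₀ of Barendregt–Bunder–Dekkers style,
following Czajka, "A semantic approach to illative combinatory logic". -/

namespace ICL

/-- Type-free λ-terms over a set `C` of primitive constants (de Bruijn representation). -/
inductive Tm (C : Type) : Type
  | var : Nat → Tm C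
  | const : C → Tm C
  | app : Tm C → Tm C → Tm C
  | lam : Tm C → Tm C

namespace Tm

variable {C : Type}

/-- Renaming of free de Bruijn variables. -/
def rename (f : Nat → Nat) : Tm C → Tm C
  | .var n => .var (f n)
  | .const c => .const c
  | .app a b => .app (a.rename f) (b.rename f)
  | .lam a => .lam (a.rename fun n => match n with | 0 => 0 | m + 1 => f m + 1)

/-- Shift all free variables up by one. -/
def lift (t : Tm C) : Tm C := t.rename (· + 1)

/-- Simultaneous (capture-avoiding) substitution. -/
def bind (σ : Nat → Tm C) : Tm C → Tm C
  | .var n => σ n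
  | .const c => .const c
  | .app a b => .app (a.bind σ) (b.bind σ)
  | .lam a => .lam (a.bind fun n => match n with | 0 => .var 0 | m + 1 => (σ m).lift)

/-- Substitution of `s` for the variable `0` (β-contraction of `(λ.t) s`). -/
def subst0 (t s : Tm C) : Tm C := t.bind fun n => match n with | 0 => s | m + 1 => .var m

/-- The set of free variables of a term. -/
def fvar : Tm C → Set Nat
  | .var n => {n}
  | .const _ => ∅
  | .app a b => fvar a ∪ fvar b
  | .lam a => {n | n + 1 ∈ fvar a}

end Tm

/-- One-step βη-reduction (closed under arbitrary contexts). -/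
inductive BetaEta {C : Type} : Tm C → Tm C → Prop
  | beta (t s : Tm C) : BetaEta (.app (.lam t) s) (t.subst0 s)
  | eta (t : Tm C) : BetaEta (.lam (.app t.lift (.var 0))) t
  | appL {t t' : Tm C} (s : Tm C) : BetaEta t t' → BetaEta (.app t s) (.app t' s)
  | appR (t : Tm C) {s s' : Tm C} : BetaEta s s' → BetaEta (.app t s) (.app t s')
  | lam {t t' : Tm C} : BetaEta t t' → BetaEta (.lam t) (.lam t')

/-- βη-convertibility `=βη`. -/
def Conv {C : Type} : Tm C → Tm C → Prop := Relation.EqvGen BetaEta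

/-- The term `Ξ`. -/
def XiT {C : Type} (cXi : C) : Tm C := .const cXi

/-- The term `L`. -/
def LT {C : Type} (cL : C) : Tm C := .const cL

/-- The term `H = λx. L (K x) = λx. L (λy. x)`. -/
def Hc {C : Type} (cL : C) : Tm C := .lam (.app (.const cL) (.lam (.var 1)))

/-- The term `⊃ = λx y. Ξ (K x) (K y)`. -/
def impC {C : Type} (cXi : C) : Tm C :=
  .lam (.lam (.app (.app (.const cXi) (.lam (.var 2))) (.lam (.var 1))))

/-- `t₁ ⊃ t₂` (infix application of `⊃`). -/
def impTm {C : Type} (cXi : C) (t1 t2 : Tm C) : Tm C := .app (.app (impC cXi) t1) t2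

/-- The term `F = λx y f. Ξ x (λz. y (f z))`. -/
def Fcomb {C : Type} (cXi : C) : Tm C :=
  .lam (.lam (.lam (.app (.app (.const cXi) (.var 2))
    (.lam (.app (.var 2) (.app (.var 1) (.var 0)))))))

/-- The term `⊥ = Ξ H I`, where `I = λx.x`. -/
def botT {C : Type} (cXi cL : C) : Tm C := .app (.app (XiT cXi) (Hc cL)) (.lam (.var 0))

/-- The double-negation axiom term `Ξ H (λx. ((x ⊃ ⊥) ⊃ ⊥) ⊃ x)`. -/
def dnAx {C : Type} (cXi cL : C) : Tm C :=
  .app (.app (XiT cXi) (Hc cL))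
    (.lam (impTm cXi (impTm cXi (impTm cXi (.var 0) (botT cXi cL)) (botT cXi cL)) (.var 0)))

/-- Free variables of a set of terms. -/
def fvS {C : Type} (Γ : Set (Tm C)) : Set Nat := ⋃ t ∈ Γ, t.fvar

/-- The illative derivability judgement `Γ ⊢ t`.  The flag `fl` enables the rule `F_L`
(giving `Iω` when `fl = true`, and `I₀` when `fl = false`); the flag `dn` enables the
double-negation axiom (giving the classical variant `Iω^c`). -/
inductive IDeriv {B C : Type} (cXi cL : C) (cA : B → C) (fl dn : Bool) :
    Set (Tm C) → Tm C → Prop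
  | ax {Γ : Set (Tm C)} {t : Tm C} : t ∈ Γ → IDeriv cXi cL cA fl dn Γ t
  | axLH {Γ : Set (Tm C)} : IDeriv cXi cL cA fl dn Γ (.app (LT cL) (Hc cL))
  | axLA {Γ : Set (Tm C)} (b : B) : IDeriv cXi cL cA fl dn Γ (.app (LT cL) (.const (cA b)))
  | axDN {Γ : Set (Tm C)} : dn = true → IDeriv cXi cL cA fl dn Γ (dnAx cXi cL)
  | eq {Γ : Set (Tm C)} {t1 t2 : Tm C} :
      IDeriv cXi cL cA fl dn Γ t1 → Conv t1 t2 → IDeriv cXi cL cA fl dn Γ t2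
  | hi {Γ : Set (Tm C)} {t : Tm C} :
      IDeriv cXi cL cA fl dn Γ t → IDeriv cXi cL cA fl dn Γ (.app (Hc cL) t)
  | xiE {Γ : Set (Tm C)} {t1 t2 t3 : Tm C} :
      IDeriv cXi cL cA fl dn Γ (.app (.app (XiT cXi) t1) t2) →
      IDeriv cXi cL cA fl dn Γ (.app t1 t3) →
      IDeriv cXi cL cA fl dn Γ (.app t2 t3)
  | xiI {Γ : Set (Tm C)} {t1 t2 : Tm C} (x : Nat) :
      IDeriv cXi cL cA fl dn (insert (.app t1 (.var x)) Γ) (.app t2 (.var x)) →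
      IDeriv cXi cL cA fl dn Γ (.app (LT cL) t1) →
      x ∉ fvS Γ → x ∉ t1.fvar → x ∉ t2.fvar →
      IDeriv cXi cL cA fl dn Γ (.app (.app (XiT cXi) t1) t2)
  | xiH {Γ : Set (Tm C)} {t1 t2 : Tm C} (x : Nat) :
      IDeriv cXi cL cA fl dn (insert (.app t1 (.var x)) Γ) (.app (Hc cL) (.app t2 (.var x))) →
      IDeriv cXi cL cA fl dn Γ (.app (LT cL) t1) →
      x ∉ fvS Γ → x ∉ t1.fvar → x ∉ t2.fvar →
      IDeriv cXi cL cA fl dn Γ (.app (Hc cL) (.app (.app (XiT cXi) t1) t2))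
  | fL {Γ : Set (Tm C)} {t1 t2 : Tm C} (x : Nat) : fl = true →
      IDeriv cXi cL cA fl dn (insert (.app t1 (.var x)) Γ) (.app (LT cL) t2) →
      IDeriv cXi cL cA fl dn Γ (.app (LT cL) t1) →
      x ∉ fvS Γ → x ∉ t1.fvar → x ∉ t2.fvar →
      IDeriv cXi cL cA fl dn Γ (.app (.app (Fcomb cXi) t1) t2)

end ICL


/-! Infrastructure: the system PRED2₀ of first-order many-sorted intuitionistic
predicate logic with second-order propositional quantifiers, and its (simplified)
Kripke semantics, following Czajka, "A semantic approach to illative combinatory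
logic", Section 2. -/

namespace PRED2

/-- Types of PRED2₀ : `τ ::= o | B | B → τ`, for a set `B` of base types. -/
inductive Ty (B : Type) : Type
  | o : Ty B
  | base : B → Ty B
  | arr : B → Ty B → Ty B
deriving DecidableEq

/-- The types over which quantification is allowed: `B ∪ {o}`. -/
def QTy {B : Type} (τ : Ty B) : Prop := τ = .o ∨ ∃ b, τ = .base b

/-- Terms of PRED2₀ over a signature `Con` (with `Con τ` the constants of type `τ`).
Variables of type `τ` are indexed by natural numbers.  Terms of type `.o` are the
formulas. -/
inductive Trm (B : Type) (Con : Ty B → Type) : Ty B → Type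
  | var (τ : Ty B) (n : Nat) : Trm B Con τ
  | con {τ : Ty B} (c : Con τ) : Trm B Con τ
  | app {b : B} {τ : Ty B} (f : Trm B Con (.arr b τ)) (a : Trm B Con (.base b)) : Trm B Con τ
  | imp (φ ψ : Trm B Con .o) : Trm B Con .o
  | all (τ : Ty B) (hτ : QTy τ) (m : Nat) (φ : Trm B Con .o) : Trm B Con .o

variable {B : Type} [DecidableEq B] {Con : Ty B → Type}

/-- Free variables of a term (a variable is a pair of its type and its index). -/
def FV : {τ : Ty B} → Trm B Con τ → Finset (Ty B × Nat)
  | _, .var τ n => {(τ, n)}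
  | _, .con _ => ∅
  | _, .app f a => FV f ∪ FV a
  | _, .imp φ ψ => FV φ ∪ FV ψ
  | _, .all τ _ m φ => (FV φ).erase (τ, m)

/-- Update a (term-valued) valuation at the variable `(τ0, m)`. -/
def vupd (v : ∀ τ : Ty B, Nat → Trm B Con τ) (τ0 : Ty B) (m : Nat) (t : Trm B Con τ0) :
    ∀ τ : Ty B, Nat → Trm B Con τ :=
  fun τ n => if h : τ = τ0 then (if n = m then h.symm ▸ t else v τ n) else v τ n

/-- The identity substitution. -/
def vid : ∀ τ : Ty B, Nat → Trm B Con τ := fun τ n => .var τ n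

/-- A number strictly larger than the index of any variable free in any `v y`
for `y ∈ s`; used to choose fresh names for bound variables. -/
def fresh (v : ∀ τ : Ty B, Nat → Trm B Con τ) (s : Finset (Ty B × Nat)) : Nat :=
  (s.sup fun y => (FV (v y.1 y.2)).sup fun z => z.2) + 1

/-- Simultaneous capture-avoiding substitution: bound variables are renamed to
fresh ones so that no free variable of the substituted terms is captured. -/
def substV (v : ∀ τ : Ty B, Nat → Trm B Con τ) : {τ : Ty B} → Trm B Con τ → Trm B Con τ
  | _, .var τ n => v τ n
  | _, .con c => .con c
  | _, .app f a => .app (substV v f) (substV v a)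
  | _, .imp φ ψ => .imp (substV v φ) (substV v ψ)
  | _, .all τ h m φ =>
      let m' := fresh v ((FV φ).erase (τ, m))
      .all τ h m' (substV (vupd v τ m (.var τ m')) φ)

/-- `φ[x/t]` : capture-avoiding substitution of the term `t` for all free
occurrences of the variable `x = (τ, m)`. -/
def subst1 (τ : Ty B) (m : Nat) (t : Trm B Con τ) {τ' : Ty B} (φ : Trm B Con τ') :
    Trm B Con τ' :=
  substV (vupd vid τ m t) φ

/-- Derivability in PRED2₀ (for a set `Δ` of hypotheses; the rules are the axiom,
`⊃`-introduction and elimination, and `∀`-introduction and elimination). -/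
inductive Deriv : Set (Trm B Con .o) → Trm B Con .o → Prop
  | ax {Δ : Set (Trm B Con .o)} {φ} : φ ∈ Δ → Deriv Δ φ
  | impI {Δ : Set (Trm B Con .o)} {φ ψ} : Deriv (insert φ Δ) ψ → Deriv Δ (.imp φ ψ)
  | impE {Δ : Set (Trm B Con .o)} {φ ψ} : Deriv Δ (.imp φ ψ) → Deriv Δ φ → Deriv Δ ψ
  | allI {Δ : Set (Trm B Con .o)} (τ : Ty B) (hτ : QTy τ) (m : Nat) {φ} :
      Deriv Δ φ → (∀ ψ ∈ Δ, (τ, m) ∉ FV ψ) → Deriv Δ (.all τ hτ m φ)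
  | allE {Δ : Set (Trm B Con .o)} {τ : Ty B} {hτ : QTy τ} {m : Nat} {φ} (t : Trm B Con τ) :
      Deriv Δ (.all τ hτ m φ) → Deriv Δ (subst1 τ m t φ)

/-- `Δ ⊢ φ` for an arbitrary set `Δ`: some finite subset of `Δ` derives `φ`. -/
def DerivFrom (Δ : Set (Trm B Con .o)) (φ : Trm B Con .o) : Prop :=
  ∃ Δ' ⊆ Δ, Δ'.Finite ∧ Deriv Δ' φ

end PRED2

namespace Embed

open ICL PRED2

/-- The primitive constants of the illative system `I₀` used for the embedding:
`Ξ`, `L`, `A_τ` for base types `τ`, and a constant for every constant of the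
PRED2₀ signature. -/
inductive SCon (B : Type) (Con : PRED2.Ty B → Type) : Type
  | Xi : SCon B Con
  | L : SCon B Con
  | A : B → SCon B Con
  | sig : {τ : PRED2.Ty B} → Con τ → SCon B Con

variable {B : Type} [DecidableEq B] {Con : PRED2.Ty B → Type}

/-- `F t₁ t₂`, written out according to the notational convention:
`λf. Ξ t₁ (λx. t₂ (f x))` if `t₂` is not a λ-abstraction, and
`λf. Ξ t₁ (λx. q₂[z/(f x)])` if `t₂ = λz. q₂`. -/
def Ft {C : Type} (cXi : C) (t1 t2 : Tm C) : Tm C :=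
  .lam (.app (.app (.const cXi) t1.lift)
    (match t2 with
     | .lam b => .lam (b.bind fun n => match n with
         | 0 => .app (.var 1) (.var 0)
         | m + 1 => .var (m + 2))
     | t2 => .lam (.app t2.lift.lift (.app (.var 1) (.var 0)))))

/-- `A_τ` : `A_o = H`, `A_τ` a constant for `τ ∈ B`, and `A_{τ₁→τ₂} = F A_{τ₁} A_{τ₂}`. -/
def Atm : PRED2.Ty B → Tm (SCon B Con)
  | .o => Hc SCon.L
  | .base b => .const (SCon.A b)
  | .arr b τ => Ft SCon.Xi (.const (SCon.A b)) (Atm τ)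

/-- The translation `⟦-⟧` from terms of PRED2₀ to λ-terms of `I₀`.  The argument
`env` assigns de Bruijn indices to the (named) free variables of PRED2₀. -/
def tr (env : PRED2.Ty B × Nat → Nat) :
    {τ : PRED2.Ty B} → Trm B Con τ → Tm (SCon B Con)
  | _, .var τ n => .var (env (τ, n))
  | _, .con c => .const (SCon.sig c)
  | _, .app f a => .app (tr env f) (tr env a)
  | _, .imp φ ψ => impTm SCon.Xi (tr env φ) (tr env ψ)
  | _, .all τ _ m φ =>
      .app (.app (XiT (SCon.Xi : SCon B Con)) (Atm τ))
        (.lam (tr (fun y => if y = (τ, m) then 0 else env y + 1) φ))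

/-- The context `Γ(Δ)` associated to a set `Δ` of formulas: it consists of
`A_τ x` for every free variable `x` of `Δ` of type `τ`, `A_τ c` for every
constant `c` of type `τ` of the signature, `L A_τ` for every base type `τ`,
and `A_τ y` for every base type `τ` and the chosen variable `y = yc τ`
(which is intended to be fresh for `Δ`). -/
def GammaSet (env : PRED2.Ty B × Nat → Nat) (Δ : Set (Trm B Con .o)) (yc : B → Nat) :
    Set (Tm (SCon B Con)) :=
  {t | ∃ (τ : PRED2.Ty B) (x : Nat), (∃ φ ∈ Δ, (τ, x) ∈ FV φ) ∧
        t = .app (Atm τ) (.var (env (τ, x)))} ∪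
  {t | ∃ (τ : PRED2.Ty B) (c : Con τ), t = .app (Atm τ) (.const (SCon.sig c))} ∪
  {t | ∃ b : B, t = .app (LT (SCon.L : SCon B Con)) (.const (SCon.A b))} ∪
  {t | ∃ b : B, t = .app (Atm (PRED2.Ty.base b)) (.var (env (PRED2.Ty.base b, yc b)))}

/-- Derivability in `I₀` from an arbitrary set of hypotheses. -/
def IDerivFrom (Γ : Set (Tm (SCon B Con))) (t : Tm (SCon B Con)) : Prop :=
  ∃ Γ' ⊆ Γ, Γ'.Finite ∧ IDeriv (SCon.Xi : SCon B Con) SCon.L SCon.A false false Γ' t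


end Embed

namespace PRED2

variable {B : Type} [DecidableEq B] {Con : Ty B → Type}

theorem vupd_same (v : ∀ τ : Ty B, Nat → Trm B Con τ) (τ : Ty B) (m : Nat) (t : Trm B Con τ) :
    vupd v τ m t τ m = t := by
  simp [vupd]

theorem vupd_of_ne (v : ∀ τ : Ty B, Nat → Trm B Con τ) {τ τ' : Ty B} {m n : Nat}
    (t : Trm B Con τ) (h : (τ', n) ≠ (τ, m)) : vupd v τ m t τ' n = v τ' n := by
  unfold vupd
  split_ifs with h1 h2
  · exact absurd (by rw [h1, h2]) h
  · rfl
  · rfl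

theorem fresh_congr {v w : ∀ τ : Ty B, Nat → Trm B Con τ} {s : Finset (Ty B × Nat)}
    (h : ∀ y ∈ s, v y.1 y.2 = w y.1 y.2) : fresh v s = fresh w s := by
  unfold fresh
  rw [Finset.sup_congr rfl fun y hy => by rw [h y hy]]

theorem lt_fresh {v : ∀ τ : Ty B, Nat → Trm B Con τ} {s : Finset (Ty B × Nat)}
    {y z : Ty B × Nat} (hy : y ∈ s) (hz : z ∈ FV (v y.1 y.2)) : z.2 < fresh v s := by
  have h1 : z.2 ≤ (FV (v y.1 y.2)).sup fun z => z.2 :=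
    Finset.le_sup (f := fun z : Ty B × Nat => z.2) hz
  have h2 : ((FV (v y.1 y.2)).sup fun z => z.2) ≤
      s.sup fun y => (FV (v y.1 y.2)).sup fun z => z.2 :=
    Finset.le_sup (f := fun y : Ty B × Nat => (FV (v y.1 y.2)).sup fun z => z.2) hy
  unfold fresh
  omega

theorem fresh_notMem {v : ∀ τ : Ty B, Nat → Trm B Con τ} {s : Finset (Ty B × Nat)}
    {y : Ty B × Nat} (hy : y ∈ s) (τ : Ty B) : (τ, fresh v s) ∉ FV (v y.1 y.2) :=
  fun h => lt_irrefl _ (lt_fresh hy h)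

theorem substV_congr {τ : Ty B} (φ : Trm B Con τ) {v w : ∀ τ : Ty B, Nat → Trm B Con τ}
    (h : ∀ y ∈ FV φ, v y.1 y.2 = w y.1 y.2) : substV v φ = substV w φ := by
  induction φ generalizing v w with
  | var τ n => exact h (τ, n) (by simp [FV])
  | con c => rfl
  | app f a ihf iha =>
    simp only [substV]
    rw [ihf fun y hy => h y (by simp [FV, hy]), iha fun y hy => h y (by simp [FV, hy])]
  | imp φ ψ ih1 ih2 =>
    simp only [substV]
    rw [ih1 fun y hy => h y (by simp [FV, hy]), ih2 fun y hy => h y (by simp [FV, hy])]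
  | all τ hτ m φ ih =>
    simp only [substV]
    have hf : fresh v ((FV φ).erase (τ, m)) = fresh w ((FV φ).erase (τ, m)) :=
      fresh_congr fun y hy => h y (by simpa [FV] using hy)
    rw [hf]
    congr 1
    refine ih fun y hy => ?_
    by_cases hy' : y = (τ, m)
    · subst hy'; simp only [vupd_same]
    · rw [vupd_of_ne _ _ hy', vupd_of_ne _ _ hy']
      exact h y (by simp [FV, hy, hy'])

/-- The free variables of `φ[v, x ↦ z]` other than `z`, when `z` is fresh. -/
theorem biUnion_vupd_erase {s : Finset (Ty B × Nat)} {v : ∀ τ : Ty B, Nat → Trm B Con τ}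
    {τ : Ty B} {m z : Nat} (hz : ∀ y ∈ s.erase (τ, m), (τ, z) ∉ FV (v y.1 y.2)) :
    (s.biUnion fun y => FV (vupd v τ m (.var τ z) y.1 y.2)).erase (τ, z) =
      (s.erase (τ, m)).biUnion fun y => FV (v y.1 y.2) := by
  ext x
  simp only [Finset.mem_erase, Finset.mem_biUnion]
  constructor
  · rintro ⟨hx, y, hy, hxy⟩
    by_cases hy' : y = (τ, m)
    · subst hy'
      simp only [vupd_same, FV, Finset.mem_singleton] at hxy
      exact absurd hxy hx
    · rw [vupd_of_ne _ _ hy'] at hxy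
      exact ⟨y, ⟨hy', hy⟩, hxy⟩
  · rintro ⟨y, ⟨hy', hy⟩, hxy⟩
    refine ⟨?_, y, hy, ?_⟩
    · rintro rfl
      exact hz y (by simp [hy, hy']) hxy
    · rwa [vupd_of_ne _ _ hy']

theorem FV_substV {τ : Ty B} (φ : Trm B Con τ) (v : ∀ τ : Ty B, Nat → Trm B Con τ) :
    FV (substV v φ) = (FV φ).biUnion fun y => FV (v y.1 y.2) := by
  induction φ generalizing v with
  | var τ n => simp [FV, substV]
  | con c => simp [FV, substV]
  | app f a ihf iha => simp [FV, substV, ihf, iha, Finset.union_biUnion]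
  | imp φ ψ ih1 ih2 => simp [FV, substV, ih1, ih2, Finset.union_biUnion]
  | all τ hτ m φ ih =>
    simp only [FV, substV, ih]
    exact biUnion_vupd_erase fun y hy => fresh_notMem hy τ

/-- Composition of valuations. -/
def vcomp (w v : ∀ τ : Ty B, Nat → Trm B Con τ) : ∀ τ : Ty B, Nat → Trm B Con τ :=
  fun τ n => substV w (v τ n)

theorem fresh_biUnion (w v : ∀ τ : Ty B, Nat → Trm B Con τ) (s : Finset (Ty B × Nat)) :
    fresh w (s.biUnion fun y => FV (v y.1 y.2)) = fresh (vcomp w v) s := by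
  simp only [fresh, vcomp, FV_substV, Finset.sup_biUnion]

theorem substV_all_of_body {φ : Trm B Con .o}
    (ih : ∀ w v : ∀ τ : Ty B, Nat → Trm B Con τ, substV w (substV v φ) = substV (vcomp w v) φ)
    (w v : ∀ τ : Ty B, Nat → Trm B Con τ) {τ : Ty B} (hτ : QTy τ) {m z : Nat}
    (hz : ∀ y ∈ (FV φ).erase (τ, m), (τ, z) ∉ FV (v y.1 y.2)) :
    substV w (.all τ hτ z (substV (vupd v τ m (.var τ z)) φ)) =
      substV (vcomp w v) (.all τ hτ m φ) := by
  simp only [substV]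
  rw [FV_substV, biUnion_vupd_erase hz, fresh_biUnion, ih]
  congr 1
  refine substV_congr φ fun y hy => ?_
  by_cases hy' : y = (τ, m)
  · subst hy'
    simp only [vcomp, vupd_same, substV]
  · rw [vupd_of_ne _ _ hy']
    simp only [vcomp]
    rw [vupd_of_ne _ _ hy']
    refine substV_congr _ fun x hx => ?_
    refine vupd_of_ne _ _ ?_
    rintro h
    rw [show x = (τ, z) from h] at hx
    exact hz y (by simp [hy, hy']) hx

theorem substV_substV {τ : Ty B} (φ : Trm B Con τ) (w v : ∀ τ : Ty B, Nat → Trm B Con τ) :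
    substV w (substV v φ) = substV (vcomp w v) φ := by
  induction φ generalizing w v with
  | var τ n => rfl
  | con c => rfl
  | app f a ihf iha => simp only [substV, ihf, iha]
  | imp φ ψ ih1 ih2 => simp only [substV, ih1, ih2]
  | all τ hτ m φ ih =>
    conv_lhs => rw [substV]
    exact substV_all_of_body ih w v hτ fun y hy => fresh_notMem hy τ

/-- The normal form of a term, in which bound variables have canonical names. -/
def norm {τ : Ty B} (φ : Trm B Con τ) : Trm B Con τ := substV vid φ

theorem norm_substV {τ : Ty B} (φ : Trm B Con τ) (v : ∀ τ : Ty B, Nat → Trm B Con τ) :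
    norm (substV v φ) = substV (fun τ n => norm (v τ n)) φ := substV_substV φ vid v

theorem norm_norm {τ : Ty B} (φ : Trm B Con τ) : norm (norm φ) = norm φ := by
  unfold norm
  rw [substV_substV]
  rfl

theorem norm_substV_congr {τ : Ty B} (φ : Trm B Con τ)
    {v w : ∀ τ : Ty B, Nat → Trm B Con τ}
    (h : ∀ y ∈ FV φ, norm (v y.1 y.2) = norm (w y.1 y.2)) :
    norm (substV v φ) = norm (substV w φ) := by
  rw [norm_substV, norm_substV]
  exact substV_congr φ h

theorem norm_all_body {φ : Trm B Con .o} (v : ∀ τ : Ty B, Nat → Trm B Con τ) {τ : Ty B}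
    (hτ : QTy τ) {m z : Nat} (hz : ∀ y ∈ (FV φ).erase (τ, m), (τ, z) ∉ FV (v y.1 y.2)) :
    norm (.all τ hτ z (substV (vupd v τ m (.var τ z)) φ)) =
      norm (substV v (.all τ hτ m φ)) := by
  rw [norm_substV]
  exact substV_all_of_body (substV_substV φ) vid v hτ hz

theorem norm_inst (φ : Trm B Con .o) (v : ∀ τ : Ty B, Nat → Trm B Con τ) {τ : Ty B} (m : Nat)
    (a : Trm B Con τ) :
    norm (subst1 τ (fresh v ((FV φ).erase (τ, m))) a
      (substV (vupd v τ m (.var τ (fresh v ((FV φ).erase (τ, m))))) φ)) =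
      norm (substV (vupd v τ m a) φ) := by
  unfold subst1
  rw [substV_substV]
  refine norm_substV_congr φ fun y hy => ?_
  by_cases hy' : y = (τ, m)
  · subst hy'
    simp only [vcomp, vupd_same, substV]
  · rw [vupd_of_ne _ _ hy']
    simp only [vcomp]
    rw [vupd_of_ne _ _ hy', ← norm_norm (v y.1 y.2)]
    congr 1
    refine substV_congr _ fun x hx => vupd_of_ne _ _ ?_
    rintro h
    rw [show x = (τ, _) from h] at hx
    exact fresh_notMem (s := (FV φ).erase (τ, m)) (by simp [hy, hy']) τ hx

theorem exists_index_bound {Γ : Set (Trm B Con .o)} (hΓ : Γ.Finite) (s : Finset (Ty B × Nat)) :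
    ∃ N, (∀ ψ ∈ Γ, ∀ y ∈ FV ψ, y.2 < N) ∧ ∀ y ∈ s, y.2 < N := by
  classical
  let u := (hΓ.toFinset.biUnion FV) ∪ s
  have hu : ∀ y ∈ u, y.2 < (u.sup fun y => y.2) + 1 := fun y hy =>
    Nat.lt_succ_of_le (Finset.le_sup (f := fun y : Ty B × Nat => y.2) hy)
  refine ⟨_, fun ψ hψ y hy => hu y ?_, fun y hy => hu y ?_⟩
  · exact Finset.mem_union_left _ (Finset.mem_biUnion.2 ⟨ψ, hΓ.mem_toFinset.2 hψ, hy⟩)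
  · exact Finset.mem_union_right _ hy

theorem Deriv.norm_intro {Γ : Set (Trm B Con .o)} (hΓ : Γ.Finite) {φ : Trm B Con .o}
    (h : Deriv Γ φ) : Deriv Γ (norm φ) := by
  obtain ⟨N, hN, hφ⟩ := exists_index_bound hΓ (FV φ)
  have h1 := Deriv.allE (.var .o N) (Deriv.allI .o (Or.inl rfl) N h fun ψ hψ hm =>
    lt_irrefl _ (hN ψ hψ _ hm))
  have h2 : subst1 .o N (.var .o N) φ = norm φ :=
    substV_congr φ fun y hy => vupd_of_ne _ _ fun e => by
      have := hφ y hy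
      rw [show y = (.o, N) from e] at this
      exact lt_irrefl _ this
  rwa [h2] at h1

/-- Bound variables may be renamed without any condition on the variables free in the
context: a formula of the shape `p`, with `p` instantiated by `φ`, shields `φ` from the
renaming performed by substitution. -/
theorem Deriv.norm_elim {Γ : Set (Trm B Con .o)} (hΓ : Γ.Finite) {φ : Trm B Con .o}
    (h : Deriv Γ (norm φ)) : Deriv Γ φ := by
  obtain ⟨N, hN, hφ⟩ := exists_index_bound hΓ (FV φ)
  have hFVn : FV (norm φ) = FV φ := by
    unfold norm
    rw [FV_substV]
    simp [vid, FV]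
  have hne : ∀ {y : Ty B × Nat} {k : Nat}, y ∈ FV (norm φ) → N ≤ k → y ≠ (.o, k) := by
    rintro y k hy hk rfl
    rw [hFVn] at hy
    have := hφ _ hy
    simp at this
    omega
  have hsub : ∀ v : ∀ τ : Ty B, Nat → Trm B Con τ,
      (∀ y ∈ FV (norm φ), v y.1 y.2 = vid y.1 y.2) → substV v (norm φ) = norm φ := fun v hv => by
    rw [substV_congr _ hv]
    exact norm_norm φ
  let r : Trm B Con .o := .var .o N
  let body : Trm B Con .o → Trm B Con .o → Trm B Con .o := fun x q =>
    .imp (.imp r r) (.imp (.imp x q) (.imp (norm φ) q))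
  let p : Trm B Con .o := .var .o (N + 1)
  let Y : Trm B Con .o := .all .o (Or.inl rfl) (N + 2) (body p (.var .o (N + 2)))
  let v : ∀ τ : Ty B, Nat → Trm B Con τ := vupd vid .o (N + 1) φ
  let q := fresh v ((FV (body p (.var .o (N + 2)))).erase (.o, N + 2))
  have hr : vupd (Con := Con) vid .o (N + 1) φ .o N = r := vupd_of_ne _ _ (by simp)
  have hq : N < q := by
    refine lt_fresh (v := v) (y := (.o, N)) (z := (.o, N)) ?_ ?_
    · simp [body, FV, r]
    · change _ ∈ FV (vupd vid .o (N + 1) φ .o N)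
      rw [hr]
      simp [r, FV]
  have hX : Deriv Γ (.all .o (Or.inl rfl) q (body φ (.var .o q))) := by
    refine Deriv.allI _ _ _ (Deriv.impI (Deriv.impI ?_)) fun ψ hψ hm => ?_
    · exact Deriv.norm_intro ((hΓ.insert _).insert _)
        (φ := .imp φ (.var .o q)) (Deriv.ax (Set.mem_insert _ _))
    · have := hN ψ hψ _ hm
      simp at this
      omega
  have hY : Deriv Γ (.all .o (Or.inl rfl) (N + 1) (.imp Y (body p p))) := by
    refine Deriv.allI _ _ _ (Deriv.impI ?_) fun ψ hψ hm => ?_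
    · have h1 := Deriv.allE (Con := Con) p (Deriv.ax (Set.mem_insert Y Γ))
      have h2 : subst1 .o (N + 2) p (body p (.var .o (N + 2))) = body p p := by
        have e1 : vupd (Con := Con) vid .o (N + 2) p .o N = r := vupd_of_ne _ _ (by simp)
        have e2 : vupd (Con := Con) vid .o (N + 2) p .o (N + 1) = p := vupd_of_ne _ _ (by simp)
        simp only [subst1, body, substV, r, p, vupd_same]
        rw [hsub _ fun y hy => vupd_of_ne _ _ (hne hy (by omega))]
        simp only [r, p] at e1 e2
        rw [e1, e2]
      rwa [h2] at h1
    · have := hN ψ hψ _ hm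
      simp at this
  have hZ := Deriv.allE φ hY
  have e : subst1 .o (N + 1) φ (.imp Y (body p p)) =
      .imp (.all .o (Or.inl rfl) q (body φ (.var .o q))) (body φ φ) := by
    have f1 : vupd (vupd (Con := Con) vid .o (N + 1) φ) .o (N + 2) (.var .o q) .o N = r := by
      rw [vupd_of_ne _ _ (by simp)]; exact hr
    have f2 : vupd (vupd (Con := Con) vid .o (N + 1) φ) .o (N + 2) (.var .o q) .o (N + 1) = φ := by
      rw [vupd_of_ne _ _ (by simp)]; exact vupd_same _ _ _ _
    have g1 : substV (vupd vid .o (N + 1) φ) (body p p) = body φ φ := by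
      simp only [body, substV, p, vupd_same]
      rw [hsub _ fun y hy => vupd_of_ne _ _ (hne hy (by omega))]
      simp only [r, substV] at hr ⊢
      rw [hr]
    have g2 : substV (vupd (vupd vid .o (N + 1) φ) .o (N + 2) (.var .o q))
        (body p (.var .o (N + 2))) = body φ (.var .o q) := by
      simp only [body, substV, p, vupd_same, f2]
      rw [hsub _ fun y hy => (vupd_of_ne _ _ (hne hy (by omega))).trans
        (vupd_of_ne _ _ (hne hy (by omega)))]
      simp only [r, substV] at f1 ⊢
      rw [f1]
    change Trm.imp (Trm.all .o _ q (substV (vupd (vupd vid .o (N + 1) φ) .o (N + 2) (.var .o q))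
      (body p (.var .o (N + 2))))) (substV (vupd vid .o (N + 1) φ) (body p p)) = _
    rw [g1, g2]
  rw [e] at hZ
  exact ((hZ.impE hX).impE (.impI (.ax (Set.mem_insert _ _)))).impE
    (.impI (.ax (Set.mem_insert _ _))) |>.impE h

theorem Deriv.of_norm_eq {Γ : Set (Trm B Con .o)} (hΓ : Γ.Finite) {φ ψ : Trm B Con .o}
    (h : Deriv Γ φ) (e : norm φ = norm ψ) : Deriv Γ ψ :=
  Deriv.norm_elim hΓ (e ▸ h.norm_intro hΓ)

theorem Deriv.substV_weaken {Γ : Set (Trm B Con .o)} {φ : Trm B Con .o} (h : Deriv Γ φ)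
    (v : ∀ τ : Ty B, Nat → Trm B Con τ) {Γ' : Set (Trm B Con .o)} (hΓ' : Γ'.Finite)
    (hsub : ∀ ψ ∈ Γ, ∃ ψ' ∈ Γ', norm ψ' = norm (substV v ψ)) : Deriv Γ' (substV v φ) := by
  induction h generalizing v Γ' with
  | ax hφ =>
    obtain ⟨ψ', h1, h2⟩ := hsub _ hφ
    exact (Deriv.ax h1).of_norm_eq hΓ' h2
  | impI _ ih =>
    refine Deriv.impI (ih v (hΓ'.insert _) ?_)
    rintro ψ (rfl | hψ)
    · exact ⟨_, Set.mem_insert _ _, rfl⟩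
    · obtain ⟨ψ', h1, h2⟩ := hsub _ hψ
      exact ⟨ψ', Set.mem_insert_of_mem _ h1, h2⟩
  | impE _ _ ih1 ih2 => exact (ih1 v hΓ' hsub).impE (ih2 v hΓ' hsub)
  | @allI Γ τ hτ m φ _ hm ih =>
    obtain ⟨N, hN, hφ⟩ := exists_index_bound hΓ' (FV (substV v (.all τ hτ m φ)))
    have h1 : Deriv Γ' (substV (vupd v τ m (.var τ N)) φ) := by
      refine ih _ hΓ' fun ψ hψ => ?_
      obtain ⟨ψ', h1, h2⟩ := hsub _ hψ
      refine ⟨ψ', h1, h2.trans ?_⟩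
      rw [substV_congr ψ fun y hy => (vupd_of_ne v (.var τ N) ?_).symm]
      rintro h
      rw [show y = (τ, m) from h] at hy
      exact hm ψ hψ hy
    refine (Deriv.allI τ hτ N h1 fun ψ hψ hm => lt_irrefl _ (hN ψ hψ _ hm)).of_norm_eq hΓ' ?_
    refine norm_all_body v hτ fun y hy hy' => ?_
    rw [FV_substV] at hφ
    exact lt_irrefl _ (hφ (τ, N) (Finset.mem_biUnion.2 ⟨y, hy, hy'⟩))
  | @allE Γ τ hτ m φ t _ ih =>
    refine ((ih v hΓ' hsub).allE (substV v t)).of_norm_eq hΓ' ?_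
    rw [norm_inst, subst1, substV_substV]
    congr 1
    refine substV_congr φ fun y hy => ?_
    by_cases hy' : y = (τ, m)
    · subst hy'
      simp only [vcomp, vupd_same]
    · rw [vupd_of_ne _ _ hy', vcomp, vupd_of_ne _ _ hy']
      rfl

theorem Deriv.weaken {Γ Γ' : Set (Trm B Con .o)} {φ : Trm B Con .o} (h : Deriv Γ φ)
    (hsub : Γ ⊆ Γ') (hΓ' : Γ'.Finite) : Deriv Γ' φ :=
  (h.substV_weaken vid hΓ' fun ψ hψ => ⟨ψ, hsub hψ, (norm_norm ψ).symm⟩).norm_elim hΓ'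

/-- Worlds of the canonical Kripke model: finite contexts. -/
abbrev World (B : Type) [DecidableEq B] (Con : Ty B → Type) :=
  {Γ : Set (Trm B Con .o) // Γ.Finite}

/-- The set of worlds at which a formula is derivable. -/
def Th (φ : Trm B Con .o) : Set (World B Con) := {w | Deriv w.1 φ}

/-- Kripke implication. -/
def kimp (S R : Set (World B Con)) : Set (World B Con) :=
  {w | ∀ w' : World B Con, w.1 ⊆ w'.1 → w' ∈ S → w' ∈ R}

theorem Th_mono (φ : Trm B Con .o) {w w' : World B Con} (h : w.1 ⊆ w'.1) (hw : w ∈ Th φ) :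
    w' ∈ Th φ := hw.weaken h w'.2

theorem Th_imp (φ ψ : Trm B Con .o) : Th (.imp φ ψ) = kimp (Th φ) (Th ψ) :=
  Set.ext fun w =>
    ⟨fun h w' hw hφ => (h.weaken hw w'.2).impE hφ, fun h =>
      Deriv.impI (h ⟨insert φ w.1, w.2.insert φ⟩ (Set.subset_insert _ _)
        (Deriv.ax (Set.mem_insert _ _)))⟩

theorem Th_all (φ : Trm B Con .o) (v : ∀ τ : Ty B, Nat → Trm B Con τ) {τ : Ty B} (hτ : QTy τ)
    (m : Nat) :
    Th (substV v (.all τ hτ m φ)) = ⋂ a : Trm B Con τ, Th (substV (vupd v τ m a) φ) := by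
  ext w
  rw [Set.mem_iInter]
  constructor
  · intro h a
    exact (h.allE a).of_norm_eq w.2 (norm_inst φ v m a)
  · intro h
    obtain ⟨N, hN, hφ⟩ := exists_index_bound w.2 (FV (substV v (.all τ hτ m φ)))
    refine (Deriv.allI τ hτ N (h (.var τ N)) fun ψ hψ hm => lt_irrefl _ (hN ψ hψ _ hm)).of_norm_eq
      w.2 ?_
    refine norm_all_body v hτ fun y hy hy' => ?_
    rw [FV_substV] at hφ
    exact lt_irrefl _ (hφ (τ, N) (Finset.mem_biUnion.2 ⟨y, hy, hy'⟩))

end PRED2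


namespace ICL

variable {C : Type}

namespace Tm

/-- The renaming `f` pushed under a binder. -/
def upr (f : Nat → Nat) : Nat → Nat
  | 0 => 0
  | m + 1 => f m + 1

/-- The substitution `σ` pushed under a binder. -/
def ups (σ : Nat → Tm C) : Nat → Tm C
  | 0 => .var 0
  | m + 1 => (σ m).lift

/-- The substitution sending `0` to `s` and `m + 1` to `σ m`. -/
def scons (s : Tm C) (σ : Nat → Tm C) : Nat → Tm C
  | 0 => s
  | m + 1 => σ m

theorem rename_lam (f : Nat → Nat) (a : Tm C) : (lam a).rename f = lam (a.rename (upr f)) := rfl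

theorem bind_lam (σ : Nat → Tm C) (a : Tm C) : (lam a).bind σ = lam (a.bind (ups σ)) := rfl

theorem subst0_eq (t s : Tm C) : t.subst0 s = t.bind (scons s var) := rfl

theorem bind_congr {t : Tm C} {σ θ : Nat → Tm C} (h : ∀ n ∈ t.fvar, σ n = θ n) :
    t.bind σ = t.bind θ := by
  induction t generalizing σ θ with
  | var n => exact h n rfl
  | const c => rfl
  | app a b iha ihb =>
    simp only [bind]
    rw [iha fun n hn => h n (Or.inl hn), ihb fun n hn => h n (Or.inr hn)]
  | lam a ih =>
    simp only [bind_lam]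
    rw [ih]
    rintro (_ | n) hn
    · rfl
    · simp only [ups]
      rw [h n hn]

theorem rename_eq_bind (t : Tm C) (f : Nat → Nat) : t.rename f = t.bind fun n => var (f n) := by
  induction t generalizing f with
  | var n => rfl
  | const c => rfl
  | app a b iha ihb => simp only [rename, bind, iha, ihb]
  | lam a ih =>
    rw [rename_lam, bind_lam, ih]
    congr 2
    funext n
    cases n <;> rfl

theorem bind_var (t : Tm C) : t.bind var = t := by
  induction t with
  | var n => rfl
  | const c => rfl
  | app a b iha ihb => simp only [bind, iha, ihb]
  | lam a ih =>
    rw [bind_lam, show ups (var : Nat → Tm C) = var by funext n; cases n <;> rfl, ih]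

theorem bind_rename (t : Tm C) (f : Nat → Nat) (σ : Nat → Tm C) :
    (t.rename f).bind σ = t.bind fun n => σ (f n) := by
  induction t generalizing f σ with
  | var n => rfl
  | const c => rfl
  | app a b iha ihb => simp only [rename, bind, iha, ihb]
  | lam a ih =>
    rw [rename_lam, bind_lam, bind_lam, ih]
    congr 2
    funext n
    cases n <;> rfl

theorem rename_rename (t : Tm C) (f g : Nat → Nat) :
    (t.rename f).rename g = t.rename fun n => g (f n) := by
  rw [rename_eq_bind _ g, bind_rename, rename_eq_bind]

theorem lift_rename (t : Tm C) (f : Nat → Nat) :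
    t.lift.rename (upr f) = (t.rename f).lift := by
  simp only [lift, rename_rename, upr]

theorem rename_bind (t : Tm C) (σ : Nat → Tm C) (f : Nat → Nat) :
    (t.bind σ).rename f = t.bind fun n => (σ n).rename f := by
  induction t generalizing f σ with
  | var n => rfl
  | const c => rfl
  | app a b iha ihb => simp only [rename, bind, iha, ihb]
  | lam a ih =>
    rw [bind_lam, rename_lam, bind_lam, ih]
    congr 2
    funext n
    cases n with
    | zero => rfl
    | succ n => exact lift_rename _ _

theorem lift_bind_ups (t : Tm C) (σ : Nat → Tm C) : t.lift.bind (ups σ) = (t.bind σ).lift := by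
  rw [lift, lift, bind_rename, rename_bind]
  rfl

theorem bind_bind (t : Tm C) (σ θ : Nat → Tm C) :
    (t.bind σ).bind θ = t.bind fun n => (σ n).bind θ := by
  induction t generalizing σ θ with
  | var n => rfl
  | const c => rfl
  | app a b iha ihb => simp only [bind, iha, ihb]
  | lam a ih =>
    rw [bind_lam, bind_lam, bind_lam, ih]
    congr 2
    funext n
    cases n with
    | zero => rfl
    | succ n => exact lift_bind_ups _ _

theorem lift_bind_scons (t s : Tm C) (σ : Nat → Tm C) : t.lift.bind (scons s σ) = t.bind σ := by
  rw [lift, bind_rename]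
  rfl

theorem lift_subst0 (t s : Tm C) : t.lift.subst0 s = t := by
  rw [subst0_eq, lift_bind_scons, bind_var]

theorem lift_injective : Function.Injective (lift : Tm C → Tm C) := fun t s h => by
  rw [← lift_subst0 t (var 0), h, lift_subst0]

theorem subst0_bind (t s : Tm C) (σ : Nat → Tm C) :
    (t.subst0 s).bind σ = (t.bind (ups σ)).subst0 (s.bind σ) := by
  rw [subst0_eq, subst0_eq, bind_bind, bind_bind]
  congr 1
  funext n
  cases n with
  | zero => rfl
  | succ n =>
    change σ n = (σ n).lift.bind _
    rw [lift_bind_scons, bind_var]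

theorem subst0_rename (t s : Tm C) (f : Nat → Nat) :
    (t.subst0 s).rename f = (t.rename (upr f)).subst0 (s.rename f) := by
  simp only [rename_eq_bind, subst0_bind]
  congr 2
  funext n
  cases n <;> rfl

theorem fvar_rename (t : Tm C) (f : Nat → Nat) : (t.rename f).fvar = f '' t.fvar := by
  induction t generalizing f with
  | var n => simp [rename, fvar]
  | const c => simp [rename, fvar]
  | app a b iha ihb => simp only [rename, fvar, iha, ihb, Set.image_union]
  | lam a ih =>
    rw [rename_lam]
    ext n
    simp only [fvar, ih, Set.mem_ofPred_eq, Set.mem_image]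
    constructor
    · rintro ⟨_ | m, hm, h⟩
      · cases h
      · exact ⟨m, hm, Nat.succ.inj h⟩
    · rintro ⟨m, hm, rfl⟩
      exact ⟨m + 1, hm, rfl⟩

theorem exists_lift_of_zero_notMem {t : Tm C} (h : 0 ∉ t.fvar) : ∃ s : Tm C, t = s.lift := by
  refine ⟨t.rename Nat.pred, ?_⟩
  rw [lift, rename_rename, rename_eq_bind]
  conv_lhs => rw [← bind_var t]
  refine bind_congr fun n hn => ?_
  cases n with
  | zero => exact absurd hn h
  | succ n => rfl

theorem rename_upr_eq_lift {t s : Tm C} {f : Nat → Nat} (h : t.rename (upr f) = s.lift) :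
    ∃ u : Tm C, t = u.lift ∧ s = u.rename f := by
  have h0 : 0 ∉ t.fvar := fun h0 => by
    have h1 : 0 ∈ (t.rename (upr f)).fvar := by
      rw [fvar_rename]
      exact ⟨0, h0, rfl⟩
    rw [h, lift, fvar_rename] at h1
    obtain ⟨m, -, hm⟩ := h1
    exact Nat.succ_ne_zero m hm
  obtain ⟨u, rfl⟩ := exists_lift_of_zero_notMem h0
  rw [lift_rename] at h
  exact ⟨u, rfl, (lift_injective h).symm⟩

end Tm

open Tm Relation

/-- One-step β-reduction. -/
inductive Beta : Tm C → Tm C → Prop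
  | beta (t s : Tm C) : Beta (.app (.lam t) s) (t.subst0 s)
  | appL {t t' : Tm C} (s : Tm C) : Beta t t' → Beta (.app t s) (.app t' s)
  | appR (t : Tm C) {s s' : Tm C} : Beta s s' → Beta (.app t s) (.app t s')
  | lam {t t' : Tm C} : Beta t t' → Beta (.lam t) (.lam t')

/-- One-step η-reduction. -/
inductive Eta : Tm C → Tm C → Prop
  | eta (t : Tm C) : Eta (.lam (.app t.lift (.var 0))) t
  | appL {t t' : Tm C} (s : Tm C) : Eta t t' → Eta (.app t s) (.app t' s)
  | appR (t : Tm C) {s s' : Tm C} : Eta s s' → Eta (.app t s) (.app t s')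
  | lam {t t' : Tm C} : Eta t t' → Eta (.lam t) (.lam t')

theorem betaEta_iff {t s : Tm C} : BetaEta t s ↔ Beta t s ∨ Eta t s := by
  constructor
  · intro h
    induction h with
    | beta t s => exact Or.inl (.beta t s)
    | eta t => exact Or.inr (.eta t)
    | appL s _ ih => exact ih.imp (.appL s) (.appL s)
    | appR t _ ih => exact ih.imp (.appR t) (.appR t)
    | lam _ ih => exact ih.imp .lam .lam
  · rintro (h | h)
    · induction h with
      | beta t s => exact .beta t s
      | appL s _ ih => exact .appL s ih
      | appR t _ ih => exact .appR t ih
      | lam _ ih => exact .lam ih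
    · induction h with
      | eta t => exact .eta t
      | appL s _ ih => exact .appL s ih
      | appR t _ ih => exact .appR t ih
      | lam _ ih => exact .lam ih

theorem Beta.bind {t s : Tm C} (h : Beta t s) (σ : Nat → Tm C) : Beta (t.bind σ) (s.bind σ) := by
  induction h generalizing σ with
  | beta t s =>
    rw [subst0_bind, Tm.bind, bind_lam]
    exact .beta _ _
  | appL s _ ih => exact .appL _ (ih σ)
  | appR t _ ih => exact .appR _ (ih σ)
  | lam _ ih =>
    rw [bind_lam, bind_lam]
    exact .lam (ih _)

theorem Eta.bind {t s : Tm C} (h : Eta t s) (σ : Nat → Tm C) : Eta (t.bind σ) (s.bind σ) := by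
  induction h generalizing σ with
  | eta t =>
    rw [bind_lam, Tm.bind, lift_bind_ups]
    exact .eta _
  | appL s _ ih => exact .appL _ (ih σ)
  | appR t _ ih => exact .appR _ (ih σ)
  | lam _ ih =>
    rw [bind_lam, bind_lam]
    exact .lam (ih _)

theorem Beta.of_rename {t : Tm C} {f : Nat → Nat} {s : Tm C} (h : Beta (t.rename f) s) :
    ∃ u, s = u.rename f ∧ Beta t u := by
  induction t generalizing f s with
  | var n => cases h
  | const c => cases h
  | app a b iha ihb =>
    rw [rename] at h
    generalize ha : a.rename f = a' at h
    generalize hb : b.rename f = b' at h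
    cases h with
    | beta t s =>
      cases a with
      | lam a =>
        rw [rename_lam] at ha
        cases ha
        subst hb
        exact ⟨_, (subst0_rename a b f).symm, .beta _ _⟩
      | _ => cases ha
    | appL _ h =>
      subst ha
      obtain ⟨u, rfl, hu⟩ := iha h
      exact ⟨.app u b, by rw [rename, hb], .appL _ hu⟩
    | appR _ h =>
      subst hb
      obtain ⟨u, rfl, hu⟩ := ihb h
      exact ⟨.app a u, by rw [rename, ha], .appR _ hu⟩
  | lam a ih =>
    rw [rename_lam] at h
    cases h with
    | lam h =>
      obtain ⟨u, rfl, hu⟩ := ih h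
      exact ⟨.lam u, (rename_lam _ _).symm, .lam hu⟩

theorem Eta.of_rename {t : Tm C} {f : Nat → Nat} {s : Tm C} (h : Eta (t.rename f) s) :
    ∃ u, s = u.rename f ∧ Eta t u := by
  induction t generalizing f s with
  | var n => cases h
  | const c => cases h
  | app a b iha ihb =>
    rw [rename] at h
    cases h with
    | appL _ h =>
      obtain ⟨u, rfl, hu⟩ := iha h
      exact ⟨.app u b, rfl, .appL _ hu⟩
    | appR _ h =>
      obtain ⟨u, rfl, hu⟩ := ihb h
      exact ⟨.app a u, rfl, .appR _ hu⟩
  | lam a ih =>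
    rw [rename_lam] at h
    generalize ha : a.rename (upr f) = a' at h
    cases h with
    | eta =>
      cases a with
      | app x y =>
        rw [rename] at ha
        injection ha with hx hy
        obtain ⟨u, rfl, rfl⟩ := rename_upr_eq_lift hx
        cases y with
        | var n =>
          cases n with
          | zero => exact ⟨u, rfl, .eta u⟩
          | succ n => injection hy with hy; cases hy
        | _ => cases hy
      | _ => cases ha
    | lam h =>
      subst ha
      obtain ⟨u, rfl, hu⟩ := ih h
      exact ⟨.lam u, (rename_lam _ _).symm, .lam hu⟩

/-- Parallel β-reduction. -/
inductive Par : Tm C → Tm C → Prop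
  | var (n : Nat) : Par (.var n) (.var n)
  | const (c : C) : Par (.const c) (.const c)
  | app {t t' s s' : Tm C} : Par t t' → Par s s' → Par (.app t s) (.app t' s')
  | lam {t t' : Tm C} : Par t t' → Par (.lam t) (.lam t')
  | beta {t t' s s' : Tm C} : Par t t' → Par s s' → Par (.app (.lam t) s) (t'.subst0 s')

theorem Par.refl (t : Tm C) : Par t t := by
  induction t with
  | var n => exact .var n
  | const c => exact .const c
  | app _ _ iha ihb => exact .app iha ihb
  | lam _ ih => exact .lam ih

theorem Beta.par {t s : Tm C} (h : Beta t s) : Par t s := by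
  induction h with
  | beta t s => exact .beta (.refl t) (.refl s)
  | appL s _ ih => exact .app ih (.refl s)
  | appR t _ ih => exact .app (.refl t) ih
  | lam _ ih => exact .lam ih

theorem Par.betaStar {t s : Tm C} (h : Par t s) : ReflTransGen Beta t s := by
  have happ : ∀ {t t' s s' : Tm C}, ReflTransGen Beta t t' → ReflTransGen Beta s s' →
      ReflTransGen Beta (.app t s) (.app t' s') := fun h1 h2 =>
    (h1.lift (fun t => Tm.app t _) fun _ _ => Beta.appL _).trans
      (h2.lift (Tm.app _) fun _ _ => Beta.appR _)
  have hlam : ∀ {t t' : Tm C}, ReflTransGen Beta t t' →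
      ReflTransGen Beta (.lam t) (.lam t') := fun h => h.lift Tm.lam fun _ _ => Beta.lam
  induction h with
  | var n => exact .refl
  | const c => exact .refl
  | app _ _ ih1 ih2 => exact happ ih1 ih2
  | lam _ ih => exact hlam ih
  | beta _ _ ih1 ih2 => exact (happ (hlam ih1) ih2).tail (.beta _ _)

theorem Par.rename {t s : Tm C} (h : Par t s) (f : Nat → Nat) :
    Par (t.rename f) (s.rename f) := by
  induction h generalizing f with
  | var n => exact .var _
  | const c => exact .const c
  | app _ _ ih1 ih2 => exact .app (ih1 f) (ih2 f)
  | lam _ ih =>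
    rw [rename_lam, rename_lam]
    exact .lam (ih _)
  | beta _ _ ih1 ih2 =>
    rw [Tm.rename, rename_lam, subst0_rename]
    exact .beta (ih1 _) (ih2 f)

theorem Par.bind {t s : Tm C} (h : Par t s) {σ θ : Nat → Tm C} (hσ : ∀ n, Par (σ n) (θ n)) :
    Par (t.bind σ) (s.bind θ) := by
  have hups : ∀ {σ θ : Nat → Tm C}, (∀ n, Par (σ n) (θ n)) → ∀ n, Par (ups σ n) (ups θ n) := by
    rintro σ θ h (_ | n)
    · exact .var 0
    · exact (h n).rename _
  induction h generalizing σ θ with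
  | var n => exact hσ n
  | const c => exact .const c
  | app _ _ ih1 ih2 => exact .app (ih1 hσ) (ih2 hσ)
  | lam _ ih =>
    rw [bind_lam, bind_lam]
    exact .lam (ih (hups hσ))
  | beta _ _ ih1 ih2 =>
    rw [Tm.bind, bind_lam, subst0_bind]
    exact .beta (ih1 (hups hσ)) (ih2 hσ)

theorem Par.subst0 {t t' s s' : Tm C} (h : Par t t') (h' : Par s s') :
    Par (t.subst0 s) (t'.subst0 s') := by
  rw [subst0_eq, subst0_eq]
  refine h.bind ?_
  rintro (_ | n)
  · exact h'
  · exact .var n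

/-- The complete development of a term. -/
def cdev : Tm C → Tm C
  | .var n => .var n
  | .const c => .const c
  | .app (.lam t) s => (cdev t).subst0 (cdev s)
  | .app t s => .app (cdev t) (cdev s)
  | .lam t => .lam (cdev t)

theorem Par.cdev {t s : Tm C} (h : Par t s) : Par s (cdev t) := by
  induction h with
  | var n => exact .var n
  | const c => exact .const c
  | @app t t' s s' h1 h2 ih1 ih2 =>
    cases t with
    | lam a =>
      cases h1 with
      | lam h1 =>
        simp only [ICL.cdev] at ih1 ⊢
        cases ih1 with
        | lam ih1 => exact .beta ih1 ih2
    | _ => exact .app ih1 ih2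
  | lam _ ih => exact .lam ih
  | beta _ _ ih1 ih2 => exact ih1.subst0 ih2

theorem betaStar_confluent {a b c : Tm C} (hb : ReflTransGen Beta a b)
    (hc : ReflTransGen Beta a c) : ∃ d, ReflTransGen Beta b d ∧ ReflTransGen Beta c d := by
  have mono : ∀ {a b : Tm C}, ReflTransGen Beta a b → ReflTransGen Par a b := fun h =>
    ReflTransGen.mono (fun _ _ => Beta.par) _ _ h
  have back : ∀ {a b : Tm C}, ReflTransGen Par a b → ReflTransGen Beta a b := fun h => by
    induction h with
    | refl => exact .refl
    | tail _ h ih => exact ih.trans h.betaStar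
  obtain ⟨d, h1, h2⟩ := church_rosser
    (fun a b c hb hc => ⟨cdev a, .single (Par.cdev hb), .single (Par.cdev hc)⟩) (mono hb) (mono hc)
  exact ⟨d, back h1, back h2⟩

theorem Eta.confluent_step {a b c : Tm C} (hb : Eta a b) (hc : Eta a c) :
    ∃ d, ReflGen Eta b d ∧ ReflGen Eta c d := by
  have key : ∀ {t u v : Tm C}, u = .app t.lift (.var 0) → Eta u v →
      ∃ d, Eta (.lam v) d ∧ Eta t d := by
    rintro t u v rfl h
    cases h with
    | appL _ h =>
      obtain ⟨u, rfl, hu⟩ := Eta.of_rename h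
      exact ⟨u, .eta u, hu⟩
    | appR _ h => cases h
  induction hb generalizing c with
  | eta t =>
    generalize hu : Tm.app t.lift (.var 0) = u at hc
    cases hc with
    | eta s =>
      injection hu with hu
      rw [lift_injective hu]
      exact ⟨c, .refl, .refl⟩
    | lam h =>
      obtain ⟨d, h1, h2⟩ := key hu.symm h
      exact ⟨d, .single h2, .single h1⟩
  | @appL t t' s h ih =>
    cases hc with
    | appL _ h' =>
      obtain ⟨d, h1, h2⟩ := ih h'
      refine ⟨.app d s, ?_, ?_⟩
      · cases h1 with
        | refl => exact .refl
        | single h1 => exact .single (.appL _ h1)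
      · cases h2 with
        | refl => exact .refl
        | single h2 => exact .single (.appL _ h2)
    | @appR _ _ s' h' => exact ⟨.app t' s', .single (.appR _ h'), .single (.appL _ h)⟩
  | @appR t s s' h ih =>
    cases hc with
    | appR _ h' =>
      obtain ⟨d, h1, h2⟩ := ih h'
      refine ⟨.app t d, ?_, ?_⟩
      · cases h1 with
        | refl => exact .refl
        | single h1 => exact .single (.appR _ h1)
      · cases h2 with
        | refl => exact .refl
        | single h2 => exact .single (.appR _ h2)
    | @appL _ t' _ h' => exact ⟨.app t' s', .single (.appL _ h'), .single (.appR _ h)⟩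
  | @lam t t' h ih =>
    generalize hu : Tm.lam t = u at hc
    cases hc with
    | eta s =>
      injection hu with hu
      obtain ⟨d, h1, h2⟩ := key hu h
      exact ⟨d, .single h1, .single h2⟩
    | lam h' =>
      injection hu with hu
      subst hu
      obtain ⟨d, h1, h2⟩ := ih h'
      refine ⟨.lam d, ?_, ?_⟩
      · cases h1 with
        | refl => exact .refl
        | single h1 => exact .single (.lam h1)
      · cases h2 with
        | refl => exact .refl
        | single h2 => exact .single (.lam h2)
    | _ => cases hu

theorem etaStar_confluent {a b c : Tm C} (hb : ReflTransGen Eta a b)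
    (hc : ReflTransGen Eta a c) : ∃ d, ReflTransGen Eta b d ∧ ReflTransGen Eta c d :=
  church_rosser (fun _ _ _ h1 h2 =>
    let ⟨d, h3, h4⟩ := h1.confluent_step h2
    ⟨d, h3, h4.to_reflTransGen⟩) hb hc

theorem etaStar_bind (t : Tm C) {σ θ : Nat → Tm C} (h : ∀ n, ReflTransGen Eta (σ n) (θ n)) :
    ReflTransGen Eta (t.bind σ) (t.bind θ) := by
  induction t generalizing σ θ with
  | var n => exact h n
  | const c => exact .refl
  | app a b iha ihb =>
    exact ((iha h).lift (fun t => Tm.app t _) fun _ _ => Eta.appL _).trans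
      ((ihb h).lift (Tm.app _) fun _ _ => Eta.appR _)
  | lam a ih =>
    rw [bind_lam, bind_lam]
    refine (ih ?_).lift Tm.lam fun _ _ => Eta.lam
    rintro (_ | n)
    · exact .refl
    · refine (h n).lift Tm.lift fun _ _ h => ?_
      change Eta (Tm.rename _ _) (Tm.rename _ _)
      rw [rename_eq_bind, rename_eq_bind]
      exact h.bind _

theorem Beta.eta_commute {a b c : Tm C} (hb : Beta a b) (hc : Eta a c) :
    ∃ d, ReflTransGen Eta b d ∧ ReflGen Beta c d := by
  induction hb generalizing c with
  | beta t s =>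
    cases hc with
    | @appL _ v _ h =>
      generalize hu : Tm.lam t = u at h
      cases h with
      | eta =>
        injection hu with hu
        subst hu
        refine ⟨.app v s, ?_, .refl⟩
        have e : (Tm.app v.lift (.var 0)).subst0 s = .app v s := by
          rw [subst0_eq, Tm.bind, lift_bind_scons, bind_var]
          rfl
        rw [e]
      | lam h =>
        injection hu with hu
        subst hu
        refine ⟨_, .single ?_, .single (.beta _ _)⟩
        rw [subst0_eq, subst0_eq]
        exact h.bind _
      | _ => cases hu
    | @appR _ _ s' h =>
      refine ⟨t.subst0 s', ?_, .single (.beta _ _)⟩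
      rw [subst0_eq, subst0_eq]
      refine etaStar_bind t ?_
      rintro (_ | n)
      · exact .single h
      · exact .refl
  | @appL t t' s h ih =>
    cases hc with
    | appL _ h' =>
      obtain ⟨d, h1, h2⟩ := ih h'
      refine ⟨.app d s, h1.lift (fun t => Tm.app t s) fun _ _ => Eta.appL _, ?_⟩
      cases h2 with
      | refl => exact .refl
      | single h2 => exact .single (.appL _ h2)
    | @appR _ _ s' h' => exact ⟨.app t' s', .single (.appR _ h'), .single (.appL _ h)⟩
  | @appR t s s' h ih =>
    cases hc with
    | appR _ h' =>
      obtain ⟨d, h1, h2⟩ := ih h'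
      refine ⟨.app t d, h1.lift (Tm.app t) fun _ _ => Eta.appR _, ?_⟩
      cases h2 with
      | refl => exact .refl
      | single h2 => exact .single (.appR _ h2)
    | @appL _ t' _ h' => exact ⟨.app t' s', .single (.appL _ h'), .single (.appR _ h)⟩
  | @lam t t' h ih =>
    generalize hu : Tm.lam t = u at hc
    cases hc with
    | eta =>
      injection hu with hu
      subst hu
      generalize hw : c.lift = w at h
      cases h with
      | beta =>
        cases c with
        | lam b0 =>
          rw [Tm.lift, rename_lam] at hw
          injection hw with hw
          subst hw
          refine ⟨.lam b0, ?_, .refl⟩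
          rw [subst0_eq, bind_rename]
          conv_rhs => rw [← bind_var b0]
          rw [show (fun n => scons (var 0) var (upr (fun x => x + 1) n)) = (var : Nat → Tm C) by
            funext n; cases n <;> rfl]
        | _ => cases hw
      | appL _ h =>
        subst hw
        obtain ⟨u, rfl, hu⟩ := Beta.of_rename h
        exact ⟨u, .single (.eta u), .single hu⟩
      | appR _ h => cases h
    | lam h' =>
      injection hu with hu
      subst hu
      obtain ⟨d, h1, h2⟩ := ih h'
      refine ⟨.lam d, h1.lift Tm.lam fun _ _ => Eta.lam, ?_⟩
      cases h2 with
      | refl => exact .refl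
      | single h2 => exact .single (.lam h2)
    | _ => cases hu

theorem betaStar_etaStar_commute {a b c : Tm C} (hb : ReflTransGen Beta a b)
    (hc : ReflTransGen Eta a c) : ∃ d, ReflTransGen Eta b d ∧ ReflTransGen Beta c d := by
  have step : ∀ {a b c : Tm C}, ReflGen Beta a b → ReflTransGen Eta a c →
      ∃ d, ReflTransGen Eta b d ∧ ReflGen Beta c d := fun hb hc => by
    induction hc with
    | refl => exact ⟨_, .refl, hb⟩
    | tail _ h ih =>
      obtain ⟨d, h1, h2⟩ := ih
      cases h2 with
      | refl => exact ⟨_, h1.tail h, .refl⟩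
      | single h2 =>
        obtain ⟨e, h3, h4⟩ := h2.eta_commute h
        exact ⟨e, h1.trans h3, h4⟩
  induction hb with
  | refl => exact ⟨_, hc, .refl⟩
  | tail _ h ih =>
    obtain ⟨d, h1, h2⟩ := ih
    obtain ⟨e, h3, h4⟩ := step (.single h) h1
    exact ⟨e, h3, h2.trans h4.to_reflTransGen⟩

/-- A β-reduction followed by an η-reduction. -/
def BetaEtaStar (a b : Tm C) : Prop := ∃ m, ReflTransGen Beta a m ∧ ReflTransGen Eta m b

theorem BetaEtaStar.diamond {a b c : Tm C} (hb : BetaEtaStar a b) (hc : BetaEtaStar a c) :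
    ∃ d, BetaEtaStar b d ∧ BetaEtaStar c d := by
  obtain ⟨m, h1, h2⟩ := hb
  obtain ⟨m', h1', h2'⟩ := hc
  obtain ⟨n, h3, h3'⟩ := betaStar_confluent h1 h1'
  obtain ⟨p, h4, h5⟩ := betaStar_etaStar_commute h3 h2
  obtain ⟨p', h4', h5'⟩ := betaStar_etaStar_commute h3' h2'
  obtain ⟨q, h6, h6'⟩ := etaStar_confluent h4 h4'
  exact ⟨q, ⟨p, h5, h6⟩, ⟨p', h5', h6'⟩⟩

theorem betaEta_confluent {a b c : Tm C} (hb : ReflTransGen BetaEta a b)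
    (hc : ReflTransGen BetaEta a c) :
    ∃ d, ReflTransGen BetaEta b d ∧ ReflTransGen BetaEta c d := by
  have mono : ∀ {a b : Tm C}, ReflTransGen BetaEta a b → ReflTransGen BetaEtaStar a b := fun h =>
    ReflTransGen.mono (fun _ _ h => (betaEta_iff.1 h).elim (fun h => ⟨_, .single h, .refl⟩)
      fun h => ⟨_, .refl, .single h⟩) _ _ h
  have back : ∀ {a b : Tm C}, ReflTransGen BetaEtaStar a b → ReflTransGen BetaEta a b :=
    fun h => by
      induction h with
      | refl => exact .refl
      | tail _ h ih =>
        obtain ⟨m, h1, h2⟩ := h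
        exact (ih.trans (ReflTransGen.mono (fun _ _ h => betaEta_iff.2 (Or.inl h)) _ _ h1)).trans
          (ReflTransGen.mono (fun _ _ h => betaEta_iff.2 (Or.inr h)) _ _ h2)
  obtain ⟨d, h1, h2⟩ := church_rosser (fun _ _ _ hb hc => by
    obtain ⟨d, h1, h2⟩ := BetaEtaStar.diamond hb hc
    exact ⟨d, .single h1, .single h2⟩) (mono hb) (mono hc)
  exact ⟨d, back h1, back h2⟩

theorem Conv.join {a b : Tm C} (h : Conv a b) :
    ∃ c, ReflTransGen BetaEta a c ∧ ReflTransGen BetaEta b c := by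
  induction h with
  | rel a b h => exact ⟨b, .single h, .refl⟩
  | refl a => exact ⟨a, .refl, .refl⟩
  | symm a b _ ih =>
    obtain ⟨c, h1, h2⟩ := ih
    exact ⟨c, h2, h1⟩
  | trans a b c _ _ ih1 ih2 =>
    obtain ⟨d, h1, h2⟩ := ih1
    obtain ⟨e, h3, h4⟩ := ih2
    obtain ⟨f, h5, h6⟩ := betaEta_confluent h2 h3
    exact ⟨f, h1.trans h5, h4.trans h6⟩

end ICL

namespace ICL

variable {C : Type}

open Tm Relation

theorem Conv.refl (t : Tm C) : Conv t t := EqvGen.refl t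

theorem Conv.symm {t s : Tm C} (h : Conv t s) : Conv s t := EqvGen.symm _ _ h

theorem Conv.trans {t s u : Tm C} (h : Conv t s) (h' : Conv s u) : Conv t u :=
  EqvGen.trans _ _ _ h h'

theorem Conv.of_eq {t s : Tm C} (h : t = s) : Conv t s := h ▸ Conv.refl t

theorem Conv.map {f : Tm C → Tm C} (hf : ∀ {t s}, BetaEta t s → Conv (f t) (f s)) {t s : Tm C}
    (h : Conv t s) : Conv (f t) (f s) := by
  induction h with
  | rel _ _ h => exact hf h
  | refl => exact .refl _
  | symm _ _ _ ih => exact ih.symm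
  | trans _ _ _ _ _ ih1 ih2 => exact ih1.trans ih2

theorem Conv.app {t t' s s' : Tm C} (h : Conv t t') (h' : Conv s s') :
    Conv (.app t s) (.app t' s') :=
  (h.map (f := fun t => .app t s) fun h => .rel _ _ (.appL _ h)).trans
    (h'.map (f := fun s => .app t' s) fun h => .rel _ _ (.appR _ h))

theorem Conv.lam {t t' : Tm C} (h : Conv t t') : Conv (.lam t) (.lam t') :=
  h.map (f := .lam) fun h => .rel _ _ (.lam h)

theorem Conv.bind {t t' : Tm C} (h : Conv t t') (σ : Nat → Tm C) :
    Conv (t.bind σ) (t'.bind σ) :=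
  h.map (f := Tm.bind σ) fun h => .rel _ _ <| betaEta_iff.2 <|
    (betaEta_iff.1 h).imp (fun h => h.bind σ) fun h => h.bind σ

theorem Conv.rename {t t' : Tm C} (h : Conv t t') (f : Nat → Nat) :
    Conv (t.rename f) (t'.rename f) := by
  rw [rename_eq_bind, rename_eq_bind]
  exact h.bind _

theorem Conv.lift {t t' : Tm C} (h : Conv t t') : Conv t.lift t'.lift := h.rename _

theorem Conv.beta (t s : Tm C) : Conv (.app (.lam t) s) (t.subst0 s) := .rel _ _ (.beta t s)

/-- Neutral terms with constants and variables at the head. -/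
inductive Ne : Tm C → Prop
  | var (n : Nat) : Ne (.var n)
  | const (c : C) : Ne (.const c)
  | app {t : Tm C} (s : Tm C) : Ne t → Ne (.app t s)

theorem Ne.var_red {n : Nat} {u : Tm C} (h : ReflTransGen BetaEta (.var n) u) : u = .var n := by
  induction h with
  | refl => rfl
  | tail _ h ih =>
    subst ih
    cases h

theorem Ne.const_red {c : C} {u : Tm C} (h : ReflTransGen BetaEta (.const c) u) :
    u = .const c := by
  induction h with
  | refl => rfl
  | tail _ h ih =>
    subst ih
    cases h

theorem Ne.step {t u : Tm C} (ht : Ne t) (h : BetaEta t u) : Ne u := by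
  induction ht generalizing u with
  | var n => cases h
  | const c => cases h
  | app s ht ih =>
    cases h with
    | beta => cases ht
    | appL _ h => exact .app _ (ih h)
    | appR _ h => exact .app _ ht

theorem Ne.app_red {t s u : Tm C} (ht : Ne t) (h : ReflTransGen BetaEta (.app t s) u) :
    ∃ t' s', u = .app t' s' ∧ Ne t' ∧ ReflTransGen BetaEta t t' ∧ ReflTransGen BetaEta s s' := by
  induction h with
  | refl => exact ⟨t, s, rfl, ht, .refl, .refl⟩
  | tail _ h ih =>
    obtain ⟨t', s', rfl, h1, h2, h3⟩ := ih
    cases h with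
    | beta => cases h1
    | appL _ h => exact ⟨_, _, rfl, h1.step h, h2.tail h, h3⟩
    | appR _ h => exact ⟨_, _, rfl, h1, h2, h3.tail h⟩

theorem Conv.of_red {t u : Tm C} (h : ReflTransGen BetaEta t u) : Conv t u := by
  induction h with
  | refl => exact .refl _
  | tail _ h ih => exact ih.trans (.rel _ _ h)

theorem Conv.of_join {t s u : Tm C} (h : ReflTransGen BetaEta t u)
    (h' : ReflTransGen BetaEta s u) : Conv t s := (Conv.of_red h).trans (Conv.of_red h').symm

theorem Conv.app_inv {t t' s s' : Tm C} (h : Conv (.app t s) (.app t' s')) (ht : Ne t)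
    (ht' : Ne t') : Conv t t' ∧ Conv s s' := by
  obtain ⟨u, h1, h2⟩ := h.join
  obtain ⟨a, b, rfl, -, h3, h4⟩ := ht.app_red h1
  obtain ⟨a', b', e, -, h3', h4'⟩ := ht'.app_red h2
  injection e with e1 e2
  subst e1 e2
  exact ⟨.of_join h3 h3', .of_join h4 h4'⟩

/-- The variable or constant at the head of a term. -/
def headOf : Tm C → Option (Nat ⊕ C)
  | .var n => some (.inl n)
  | .const c => some (.inr c)
  | .app t _ => headOf t
  | .lam _ => none

theorem Ne.head_step {t u : Tm C} (ht : Ne t) (h : BetaEta t u) : headOf u = headOf t := by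
  induction ht generalizing u with
  | var n => cases h
  | const c => cases h
  | app s ht ih =>
    cases h with
    | beta => cases ht
    | appL _ h' => exact (ih h' :)
    | appR _ _ => rfl

theorem Ne.head_red {t u : Tm C} (ht : Ne t) (h : ReflTransGen BetaEta t u) :
    Ne u ∧ headOf u = headOf t := by
  induction h with
  | refl => exact ⟨ht, rfl⟩
  | tail _ h ih => exact ⟨ih.1.step h, (ih.1.head_step h).trans ih.2⟩

theorem Conv.head_eq {t s : Tm C} (h : Conv t s) (ht : Ne t) (hs : Ne s) :
    headOf t = headOf s := by
  obtain ⟨u, h1, h2⟩ := h.join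
  rw [← (ht.head_red h1).2, (hs.head_red h2).2]

theorem Conv.not_app_const {t s : Tm C} {c : C} (ht : Ne t) : ¬ Conv (.app t s) (.const c) :=
  fun h => by
    obtain ⟨u, h1, h2⟩ := h.join
    obtain ⟨_, _, rfl, -⟩ := ht.app_red h1
    cases Ne.const_red h2

theorem Conv.not_app_var {t s : Tm C} {n : Nat} (ht : Ne t) : ¬ Conv (.app t s) (.var n) :=
  fun h => by
    obtain ⟨u, h1, h2⟩ := h.join
    obtain ⟨_, _, rfl, -⟩ := ht.app_red h1
    cases Ne.var_red h2

/-- The constant function `K t`. -/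
def Kt (t : Tm C) : Tm C := .lam t.lift

theorem Conv.Kt_app (t s : Tm C) : Conv (.app (ICL.Kt t) s) t :=
  (Conv.beta _ _).trans (.of_eq (lift_subst0 t s))

theorem Conv.Kt_inv {t s : Tm C} (h : Conv (ICL.Kt t) (ICL.Kt s)) : Conv t s :=
  (Conv.Kt_app t (.var 0)).symm.trans ((h.app (.refl _)).trans (Conv.Kt_app s _))

theorem Kt_bind (t : Tm C) (σ : Nat → Tm C) : (Kt t).bind σ = Kt (t.bind σ) := by
  rw [Kt, bind_lam, lift_bind_ups, Kt]

theorem Conv.Hc_app (cL : C) (t : Tm C) :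
    Conv (.app (Hc cL) t) (.app (.const cL) (ICL.Kt t)) := Conv.beta _ _

theorem Conv.impTm_eq (cXi : C) (t s : Tm C) :
    Conv (impTm cXi t s) (.app (.app (.const cXi) (ICL.Kt t)) (ICL.Kt s)) := by
  refine ((Conv.beta _ _).app (.refl _)).trans ((Conv.beta _ _).trans (.of_eq ?_))
  change Tm.app (.app (.const cXi) (.lam (Tm.bind _ t.lift.lift))) (ICL.Kt s) = _
  congr 3
  exact (lift_bind_ups _ _).trans (congrArg Tm.lift (lift_subst0 t s))

theorem Conv.var_inj {n m : Nat} (h : Conv (.var n : Tm C) (.var m)) : n = m := by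
  have := h.head_eq (.var n) (.var m)
  simpa [headOf] using this

theorem Conv.const_inj {c d : C} (h : Conv (.const c : Tm C) (.const d)) : c = d := by
  have := h.head_eq (.const c) (.const d)
  simpa [headOf] using this

theorem Conv.not_Kt_const {t : Tm C} {c : C} : ¬ Conv (ICL.Kt t) (.const c) := fun h => by
  have h1 : ∀ s, Conv t (.app (.const c) s) := fun s =>
    (Conv.Kt_app t s).symm.trans (h.app (.refl s))
  have h2 := ((h1 (.var 0)).symm.trans (h1 (.var 1))).app_inv (.const c) (.const c)
  exact absurd h2.2.var_inj (by simp)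

theorem Conv.not_Kt_Hc {t : Tm C} {cL : C} : ¬ Conv (ICL.Kt t) (Hc cL) := fun h => by
  have h1 : ∀ s, Conv t (.app (.const cL) (ICL.Kt s)) := fun s =>
    (Conv.Kt_app t s).symm.trans ((h.app (.refl s)).trans (Conv.Hc_app cL s))
  have h2 := ((h1 (.var 0)).symm.trans (h1 (.var 1))).app_inv (.const cL) (.const cL)
  exact absurd h2.2.Kt_inv.var_inj (by simp)

theorem Conv.not_const_Hc {c cL : C} (hc : c ≠ cL) : ¬ Conv (.const c) (Hc cL) := fun h => by
  have h1 := ((h.app (.refl (.var 0))).trans (Conv.Hc_app cL (.var 0))).head_eq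
    (.app _ (.const c)) (.app _ (.const cL))
  simp only [headOf, Option.some.injEq, Sum.inr.injEq] at h1
  exact hc h1

end ICL

namespace Embed

open ICL PRED2 Tm

variable {B : Type} [DecidableEq B] {Con : PRED2.Ty B → Type}

/-- Domains of the canonical model. -/
abbrev Dom (Con : Ty B → Type) : Ty B → Type
  | .o => Set (World B Con)
  | .base b => Trm B Con (.base b)
  | .arr b τ => Trm B Con (.arr b τ)

/-- The canonical interpretation of PRED2₀ terms. -/
def interp : {τ : Ty B} → Trm B Con τ → Dom Con τ
  | .o, φ => Th φ
  | .base _, a => a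
  | .arr _ _, a => a

/-- Assignments of a value of every type to every de Bruijn variable. -/
abbrev Env (Con : Ty B → Type) : Type := Nat → ∀ τ : Ty B, Dom Con τ

/-- The assignment induced by a valuation. -/
def envOf (v : ∀ τ : Ty B, Nat → Trm B Con τ) : Env Con := fun n τ => interp (v τ n)

/-- Extension of a valuation by a term for the variable `0`. -/
def vcons {τ : Ty B} (a : Trm B Con τ) (v : ∀ τ : Ty B, Nat → Trm B Con τ) :
    ∀ τ : Ty B, Nat → Trm B Con τ
  | τ', 0 => if h : τ' = τ then h ▸ a else .var τ' 0
  | τ', n + 1 => v τ' n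

/-- Extension of a valuation by an irrelevant value for the variable `0`. -/
def vskip (v : ∀ τ : Ty B, Nat → Trm B Con τ) : ∀ τ : Ty B, Nat → Trm B Con τ
  | τ', 0 => .var τ' 0
  | τ', n + 1 => v τ' n

/-- Extension of an assignment by a value for the variable `0`. -/
def econs {τ : Ty B} (a : Dom Con τ) (η : Env Con) : Env Con
  | 0, τ' => if h : τ' = τ then h ▸ a else interp (.var τ' 0)
  | n + 1, τ' => η n τ'

/-- Extension of an assignment by an irrelevant value for the variable `0`. -/
def eskip (η : Env Con) : Env Con
  | 0, τ' => interp (.var τ' 0)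
  | n + 1, τ' => η n τ'

/-- The assignment with the value of the variable `0` removed. -/
def etail (η : Env Con) : Env Con := fun n => η (n + 1)

theorem vcons_zero {τ : Ty B} (a : Trm B Con τ) (v : ∀ τ : Ty B, Nat → Trm B Con τ) :
    vcons a v τ 0 = a := by
  simp [vcons]

theorem econs_zero {τ : Ty B} (a : Dom Con τ) (η : Env Con) : econs a η 0 τ = a := by
  simp [econs]

theorem econs_envOf {τ : Ty B} (a : Trm B Con τ) (v : ∀ τ : Ty B, Nat → Trm B Con τ) :
    econs (interp a) (envOf v) = envOf (vcons a v) := by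
  funext n τ'
  cases n with
  | zero =>
    by_cases h : τ' = τ
    · subst h
      rw [econs_zero, envOf, vcons_zero]
    · simp [econs, envOf, vcons, h]
  | succ n => rfl

theorem eskip_rename (η : Env Con) (r : Nat → Nat) :
    (fun n => eskip η (upr r n)) = eskip fun n => η (r n) := by
  funext n
  cases n <;> rfl

theorem econs_rename {τ : Ty B} (a : Dom Con τ) (η : Env Con) (r : Nat → Nat) :
    (fun n => econs a η (upr r n)) = econs a fun n => η (r n) := by
  funext n
  cases n <;> rfl

theorem eskip_envOf (v : ∀ τ : Ty B, Nat → Trm B Con τ) :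
    eskip (envOf v) = envOf (vskip v) := by
  funext n τ'
  cases n <;> rfl

/-- Partial typing contexts for de Bruijn variables. -/
abbrev TCtx (B : Type) : Type := Nat → Option (Ty B)

/-- Extension of a typing context. -/
def tcons (o : Option (Ty B)) (T : TCtx B) : TCtx B
  | 0 => o
  | n + 1 => T n

/-- Denotations of λ-terms which literally are first-order terms. -/
inductive DenN (T : TCtx B) :
    (τ : Ty B) → Tm (SCon B Con) → (Env Con → Dom Con τ) → Prop
  | var {τ : Ty B} {n : Nat} : T n = some τ → DenN T τ (.var n) fun η => η n τ
  | con {τ : Ty B} (c : Con τ) : DenN T τ (.const (.sig c)) fun _ => interp (.con c)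
  | app {b : B} {τ : Ty B} {t s : Tm (SCon B Con)} {f : Env Con → Dom Con (.arr b τ)}
      {a : Env Con → Dom Con (.base b)} : DenN T (.arr b τ) t f → DenN T (.base b) s a →
      DenN T τ (.app t s) fun η => interp (.app (f η) (a η))

/-- The term `Ξ t s`. -/
abbrev xi (t s : Tm (SCon B Con)) : Tm (SCon B Con) := .app (.app (XiT .Xi) t) s

/-- Denotations of λ-terms which are propositions. -/
inductive Den : TCtx B → Tm (SCon B Con) → (Env Con → Set (World B Con)) → Prop
  | atom {T : TCtx B} {t t' : Tm (SCon B Con)} {f : Env Con → Dom Con .o} :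
      Conv t t' → DenN T .o t' f → Den T t f
  | imp {T : TCtx B} {t p u : Tm (SCon B Con)} {f g : Env Con → Set (World B Con)} :
      Conv t (xi (Kt p) u) → Den T p f → Den (tcons none T) (.app u.lift (.var 0)) g →
      Den T t fun η => kimp (f η) (g (eskip η))
  | all {T : TCtx B} {t u : Tm (SCon B Con)} {τ : Ty B} {g : Env Con → Set (World B Con)} :
      QTy τ → Conv t (xi (Atm τ) u) → Den (tcons (some τ) T) (.app u.lift (.var 0)) g →
      Den T t fun η => ⋂ a : Trm B Con τ, g (econs (interp a) η)
  | memA {T : TCtx B} {t s : Tm (SCon B Con)} {b : B} {f : Env Con → Dom Con (.base b)} :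
      Conv t (.app (.const (.A b)) s) → DenN T (.base b) s f → Den T t fun _ => Set.univ
  | lA {T : TCtx B} {t : Tm (SCon B Con)} (b : B) :
      Conv t (.app (ICL.LT .L) (.const (.A b))) → Den T t fun _ => Set.univ
  | lH {T : TCtx B} {t : Tm (SCon B Con)} :
      Conv t (.app (ICL.LT .L) (Hc .L)) → Den T t fun _ => Set.univ
  | lK {T : TCtx B} {t p : Tm (SCon B Con)} {f : Env Con → Set (World B Con)} :
      Conv t (.app (ICL.LT .L) (Kt p)) → Den T p f → Den T t fun _ => Set.univ

/-- Denotations of λ-terms of arbitrary type, up to conversion. -/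
def Val (T : TCtx B) : (τ : Ty B) → Tm (SCon B Con) → (Env Con → Dom Con τ) → Prop
  | .o, t, f => Den T t f
  | .base b, t, f => ∃ t', Conv t t' ∧ DenN T (.base b) t' f
  | .arr b τ, t, f => ∃ t', Conv t t' ∧ DenN T (.arr b τ) t' f

theorem Den.conv {T : TCtx B} {t s : Tm (SCon B Con)} {f : Env Con → Set (World B Con)}
    (h : Den T t f) (c : Conv t s) : Den T s f := by
  cases h with
  | atom c' h => exact .atom (c.symm.trans c') h
  | imp c' h1 h2 => exact .imp (c.symm.trans c') h1 h2
  | all hτ c' h => exact .all hτ (c.symm.trans c') h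
  | memA c' h => exact .memA (c.symm.trans c') h
  | lA b c' => exact .lA b (c.symm.trans c')
  | lH c' => exact .lH (c.symm.trans c')
  | lK c' h => exact .lK (c.symm.trans c') h

theorem DenN.val {T : TCtx B} {τ : Ty B} {t t' : Tm (SCon B Con)} {f : Env Con → Dom Con τ}
    (h : DenN T τ t' f) (c : Conv t t') : Val T τ t f := by
  cases τ with
  | o => exact .atom c h
  | base b => exact ⟨t', c, h⟩
  | arr b τ => exact ⟨t', c, h⟩

theorem Val.app {T : TCtx B} {b : B} {τ : Ty B} {t s : Tm (SCon B Con)}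
    {f : Env Con → Dom Con (.arr b τ)} {a : Env Con → Dom Con (.base b)}
    (h : Val T (.arr b τ) t f) (h' : Val T (.base b) s a) :
    Val T τ (.app t s) fun η => interp (.app (f η) (a η)) := by
  obtain ⟨t', c, h⟩ := h
  obtain ⟨s', c', h'⟩ := h'
  exact (h.app h').val (c.app c')

theorem Val.var {T : TCtx B} {τ : Ty B} {n : Nat} (h : T n = some τ) :
    Val (Con := Con) T τ (.var n) fun η => η n τ := (DenN.var h).val (.refl _)

/-- The combinator `F t s` applied to `u`. -/
theorem Ft_conv {C : Type} (cXi : C) (t s : Tm C) :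
    Conv (Ft cXi t s) (.lam (.app (.app (.const cXi) t.lift)
      (.lam (.app s.lift.lift (.app (.var 1) (.var 0)))))) := by
  cases s with
  | lam b =>
    refine Conv.lam (Conv.app (.refl _) (Conv.lam ?_))
    refine (Conv.of_eq ?_).trans (Conv.beta _ _).symm
    rw [subst0_eq]
    change _ = Tm.bind _ ((b.rename (upr _)).rename (upr _))
    rw [rename_rename, bind_rename]
    congr 1
    funext n
    cases n <;> rfl
  | _ => exact .refl _

theorem Atm_bind {B : Type} {Con : Ty B → Type} (τ : Ty B) (σ : Nat → Tm (SCon B Con)) :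
    Conv ((Atm τ).bind σ) (Atm τ) := by
  induction τ generalizing σ with
  | o => exact .refl _
  | base b => exact .refl _
  | arr b τ ih =>
    refine ((Ft_conv _ _ _).bind σ).trans (Conv.trans ?_ (Ft_conv _ _ _).symm)
    refine Conv.lam (Conv.app (.refl _) (Conv.lam (Conv.app ?_ (.refl _))))
    change Conv ((Tm.lift (Tm.lift (Atm τ))).bind (ups (ups σ))) _
    rw [lift_bind_ups, lift_bind_ups]
    exact (ih σ).lift.lift

theorem Atm_rename {B : Type} {Con : Ty B → Type} (τ : Ty B) (r : Nat → Nat) :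
    Conv ((Atm τ : Tm (SCon B Con)).rename r) (Atm τ) := by
  rw [rename_eq_bind]
  exact Atm_bind τ _

theorem Atm_arr_app {B : Type} {Con : Ty B → Type} (b : B) (τ : Ty B) (s : Tm (SCon B Con)) :
    Conv (.app (Atm (.arr b τ)) s)
      (xi (Atm (.base b)) (.lam (.app (Atm τ) (.app s.lift (.var 0))))) := by
  refine ((Ft_conv _ _ _).app (.refl s)).trans ((Conv.beta _ _).trans ?_)
  refine Conv.app (.refl _) (Conv.lam (Conv.app ?_ (.refl _)))
  change Conv ((Tm.lift (Tm.lift (Atm τ))).bind (ups (scons s var))) _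
  rw [lift_bind_ups, lift_bind_scons, bind_var]
  exact Atm_rename τ _

theorem DenN.rename {T T' : TCtx B} {τ : Ty B} {t : Tm (SCon B Con)}
    {f : Env Con → Dom Con τ} (h : DenN T τ t f) {r : Nat → Nat}
    (hr : ∀ n τ, T n = some τ → T' (r n) = some τ) :
    DenN T' τ (t.rename r) fun η => f fun n => η (r n) := by
  induction h with
  | var h => exact .var (hr _ _ h)
  | con c => exact .con c
  | app _ _ ih1 ih2 => exact .app ih1 ih2

theorem tcons_rename {B : Type} {T T' : TCtx B} {r : Nat → Nat}
    (hr : ∀ n τ, T n = some τ → T' (r n) = some τ) (o : Option (Ty B)) (n : Nat) (τ : Ty B)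
    (h : tcons o T n = some τ) : tcons o T' (upr r n) = some τ := by
  cases n with
  | zero => exact h
  | succ n => exact hr n τ h

theorem Den.rename {T T' : TCtx B} {t : Tm (SCon B Con)}
    {f : Env Con → Set (World B Con)} (h : Den T t f) {r : Nat → Nat}
    (hr : ∀ n τ, T n = some τ → T' (r n) = some τ) :
    Den T' (t.rename r) fun η => f fun n => η (r n) := by
  induction h generalizing T' r with
  | atom c h => exact .atom (c.rename r) (h.rename hr)
  | @imp T t p u f g c _ _ ih1 ih2 =>
    have h2 := ih2 (tcons_rename hr none)
    rw [Tm.rename, lift_rename] at h2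
    have e : Tm.rename r (xi (Kt p) u) = xi (Kt (p.rename r)) (u.rename r) := by
      simp only [xi, Tm.rename, Kt, rename_lam, lift_rename, XiT]
    have h3 := Den.imp ((c.rename r).trans (.of_eq e)) (ih1 hr) h2
    simp only [eskip_rename] at h3
    exact h3
  | @all T t u τ g hτ c _ ih =>
    have h2 := ih (tcons_rename hr (some τ))
    rw [Tm.rename, lift_rename] at h2
    have h3 := Den.all hτ ((c.rename r).trans
      (Conv.app (Conv.app (.refl _) (Atm_rename τ r)) (.refl _))) h2
    simp only [econs_rename] at h3
    exact h3
  | memA c h => exact .memA (c.rename r) (h.rename hr)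
  | lA b c => exact .lA b (c.rename r)
  | lH c => exact .lH (c.rename r)
  | @lK T t p f c _ ih =>
    have e : Tm.rename r (.app (ICL.LT .L) (Kt p)) =
        (.app (ICL.LT .L) (Kt (p.rename r)) : Tm (SCon B Con)) := by
      simp only [Tm.rename, Kt, rename_lam, lift_rename, ICL.LT]
    exact .lK ((c.rename r).trans (.of_eq e)) (ih hr)

theorem Val.rename {T T' : TCtx B} {τ : Ty B} {t : Tm (SCon B Con)}
    {f : Env Con → Dom Con τ} (h : Val T τ t f) {r : Nat → Nat}
    (hr : ∀ n τ, T n = some τ → T' (r n) = some τ) :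
    Val T' τ (t.rename r) fun η => f fun n => η (r n) := by
  cases τ with
  | o => exact Den.rename h hr
  | base b =>
    obtain ⟨t', c, h⟩ := h
    exact ⟨_, c.rename r, h.rename hr⟩
  | arr b τ =>
    obtain ⟨t', c, h⟩ := h
    exact ⟨_, c.rename r, h.rename hr⟩

theorem Den.lift {T : TCtx B} {t : Tm (SCon B Con)} {f : Env Con → Set (World B Con)}
    (h : Den T t f) (o : Option (Ty B)) : Den (tcons o T) t.lift fun η => f (etail η) :=
  h.rename fun _ _ h => h

theorem Val.lift {T : TCtx B} {τ : Ty B} {t : Tm (SCon B Con)} {f : Env Con → Dom Con τ}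
    (h : Val T τ t f) (o : Option (Ty B)) : Val (tcons o T) τ t.lift fun η => f (etail η) :=
  h.rename fun _ _ h => h

theorem DenN.bind {T T' : TCtx B} {τ : Ty B} {t : Tm (SCon B Con)}
    {f : Env Con → Dom Con τ} (h : DenN T τ t f) {σ : Nat → Tm (SCon B Con)}
    {θ : Nat → ∀ τ, Env Con → Dom Con τ}
    (hσ : ∀ n τ, T n = some τ → Val T' τ (σ n) (θ n τ)) :
    Val T' τ (t.bind σ) fun η => f fun n τ => θ n τ η := by
  induction h with
  | var h => exact hσ _ _ h
  | con c => exact (DenN.con c).val (.refl _)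
  | app _ _ ih1 ih2 => exact ih1.app ih2

/-- A family of denotations pushed under a binder. -/
def dups (θ : Nat → ∀ τ, Env Con → Dom Con τ) : Nat → ∀ τ, Env Con → Dom Con τ
  | 0, τ => fun η => η 0 τ
  | n + 1, τ => fun η => θ n τ (etail η)

theorem dups_eskip (θ : Nat → ∀ τ, Env Con → Dom Con τ) (η : Env Con) :
    (fun n τ => dups θ n τ (eskip η)) = eskip fun n τ => θ n τ η := by
  funext n τ
  cases n <;> rfl

theorem dups_econs (θ : Nat → ∀ τ, Env Con → Dom Con τ) (η : Env Con) {τ : Ty B}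
    (a : Dom Con τ) : (fun n τ => dups θ n τ (econs a η)) = econs a fun n τ => θ n τ η := by
  funext n τ
  cases n <;> rfl

theorem val_ups {T T' : TCtx B} {σ : Nat → Tm (SCon B Con)}
    {θ : Nat → ∀ τ, Env Con → Dom Con τ}
    (hσ : ∀ n τ, T n = some τ → Val T' τ (σ n) (θ n τ)) (o : Option (Ty B)) (n : Nat) (τ : Ty B)
    (h : tcons o T n = some τ) : Val (tcons o T') τ (ups σ n) (dups θ n τ) := by
  cases n with
  | zero => exact Val.var h
  | succ n => exact (hσ n τ h).lift o

theorem Den.bind {T T' : TCtx B} {t : Tm (SCon B Con)}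
    {f : Env Con → Set (World B Con)} (h : Den T t f) {σ : Nat → Tm (SCon B Con)}
    {θ : Nat → ∀ τ, Env Con → Dom Con τ}
    (hσ : ∀ n τ, T n = some τ → Val T' τ (σ n) (θ n τ)) :
    Den T' (t.bind σ) fun η => f fun n τ => θ n τ η := by
  induction h generalizing T' σ θ with
  | atom c h => exact Den.conv (h.bind hσ) (c.bind σ).symm
  | @imp T t p u f g c _ _ ih1 ih2 =>
    have h2 := ih2 (val_ups hσ none)
    rw [Tm.bind, lift_bind_ups] at h2
    have e : Tm.bind σ (xi (Kt p) u) = xi (Kt (p.bind σ)) (u.bind σ) := by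
      simp only [xi, Tm.bind, Kt_bind, XiT]
    have h3 := Den.imp ((c.bind σ).trans (.of_eq e)) (ih1 hσ) h2
    simp only [dups_eskip] at h3
    exact h3
  | @all T t u τ g hτ c _ ih =>
    have h2 := ih (val_ups hσ (some τ))
    rw [Tm.bind, lift_bind_ups] at h2
    have h3 := Den.all hτ ((c.bind σ).trans
      (Conv.app (Conv.app (.refl _) (Atm_bind τ σ)) (.refl _))) h2
    simp only [dups_econs] at h3
    exact h3
  | memA c h =>
    obtain ⟨s', c', h'⟩ := h.bind hσ
    exact .memA ((c.bind σ).trans (.app (.refl _) c')) h'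
  | lA b c => exact .lA b (c.bind σ)
  | lH c => exact .lH (c.bind σ)
  | @lK T t p f c _ ih =>
    have e : Tm.bind σ (.app (ICL.LT .L) (Kt p)) =
        (.app (ICL.LT .L) (Kt (p.bind σ)) : Tm (SCon B Con)) := by
      simp only [Tm.bind, Kt_bind, ICL.LT]
    exact .lK ((c.bind σ).trans (.of_eq e)) (ih hσ)

theorem DenN.ne {T : TCtx B} {τ : Ty B} {t : Tm (SCon B Con)} {f : Env Con → Dom Con τ}
    (h : DenN T τ t f) : Ne t := by
  induction h with
  | var _ => exact .var _
  | con c => exact .const _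
  | app _ _ ih _ => exact .app _ ih

theorem DenN.head_ne {T : TCtx B} {τ : Ty B} {t : Tm (SCon B Con)} {f : Env Con → Dom Con τ}
    (h : DenN T τ t f) {c : SCon B Con} (hc : ∀ (τ : Ty B) (d : Con τ), c ≠ .sig d) :
    headOf t ≠ some (.inr c) := by
  induction h with
  | var _ => simp [headOf]
  | @con τ d =>
    simp only [headOf, ne_eq, Option.some.injEq, Sum.inr.injEq]
    exact fun e => hc τ d e.symm
  | app _ _ ih _ => exact ih

theorem DenN.not_conv {T : TCtx B} {τ : Ty B} {t s : Tm (SCon B Con)}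
    {f : Env Con → Dom Con τ} (h : DenN T τ t f) {c : SCon B Con} (hs : Ne s)
    (hc : ∀ (τ : Ty B) (d : Con τ), c ≠ .sig d) (e : headOf s = some (.inr c)) : ¬ Conv t s :=
  fun h' => h.head_ne hc ((h'.head_eq h.ne hs).trans e)

theorem DenN.unique {T : TCtx B} {τ τ' : Ty B} {t t' : Tm (SCon B Con)}
    {f : Env Con → Dom Con τ} {f' : Env Con → Dom Con τ'} (h : DenN T τ t f)
    (h' : DenN T τ' t' f') (c : Conv t t') :
    (⟨τ, f⟩ : Σ τ, Env Con → Dom Con τ) = ⟨τ', f'⟩ := by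
  induction h generalizing τ' t' with
  | @var τ n hn =>
    cases h' with
    | @var τ' n' hn' =>
      obtain rfl := c.var_inj
      rw [hn] at hn'
      cases hn'
      rfl
    | con d => exact absurd (c.head_eq (.var _) (.const _)) (by simp [headOf])
    | app h1 _ => exact (c.symm.not_app_var h1.ne).elim
  | con d =>
    cases h' with
    | var _ => exact absurd (c.head_eq (.const _) (.var _)) (by simp [headOf])
    | con d' =>
      cases c.const_inj
      rfl
    | app h1 _ => exact (c.symm.not_app_const h1.ne).elim
  | app h1 h2 ih1 ih2 =>
    cases h' with
    | var _ => exact (c.not_app_var h1.ne).elim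
    | con d' => exact (c.not_app_const h1.ne).elim
    | app h1' h2' =>
      obtain ⟨c1, c2⟩ := c.app_inv h1.ne h1'.ne
      cases ih1 h1' c1
      cases ih2 h2' c2
      rfl

end Embed

namespace Embed

open ICL PRED2 Tm

variable {B : Type} [DecidableEq B] {Con : PRED2.Ty B → Type}

theorem ne_xi {B : Type} {Con : Ty B → Type} (t s : Tm (SCon B Con)) : Ne (xi t s) := .app _
    (.app _ (.const _))

theorem xi_inv {B : Type} {Con : Ty B → Type} {t t' s s' : Tm (SCon B Con)} (h : Conv (xi t s)
    (xi t' s')) :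
    Conv t t' ∧ Conv s s' := by
  obtain ⟨h1, h2⟩ := h.app_inv (.app _ (.const _)) (.app _ (.const _))
  exact ⟨(h1.app_inv (.const _) (.const _)).2, h2⟩

theorem not_Kt_Atm {B : Type} {Con : Ty B → Type} {τ : Ty B} (hτ : QTy τ) {t : Tm
    (SCon B Con)} : ¬ Conv (Kt t) (Atm τ) := by
  rcases hτ with rfl | ⟨b, rfl⟩
  · exact Conv.not_Kt_Hc
  · exact Conv.not_Kt_const

theorem Atm_inj {B : Type} {Con : Ty B → Type} {τ τ' : Ty B} (hτ : QTy τ) (hτ' : QTy τ')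
    (h : Conv (Atm τ : Tm (SCon B Con)) (Atm τ')) : τ = τ' := by
  rcases hτ with rfl | ⟨b, rfl⟩ <;> rcases hτ' with rfl | ⟨b', rfl⟩
  · rfl
  · exact (Conv.not_const_Hc (by simp) h.symm).elim
  · exact (Conv.not_const_Hc (by simp) h).elim
  · cases h.const_inj
    rfl

theorem Den.xi_inv {T : TCtx B} {t t1 t2 : Tm (SCon B Con)} {F : Env Con → Set (World B Con)}
    (h : Den T t F) (c : Conv t (xi t1 t2)) :
    (∃ p f g, Conv t1 (Kt p) ∧ Den T p f ∧ Den (tcons none T) (.app t2.lift (.var 0)) g ∧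
      F = fun η => kimp (f η) (g (eskip η))) ∨
    ∃ τ g, QTy τ ∧ Conv t1 (Atm τ) ∧ Den (tcons (some τ) T) (.app t2.lift (.var 0)) g ∧
      F = fun η => ⋂ a : Trm B Con τ, g (econs (interp a) η) := by
  have hne := ne_xi t1 t2
  cases h with
  | atom c' h => exact (h.not_conv hne (by simp) rfl (c'.symm.trans c)).elim
  | imp c' h1 h2 =>
    obtain ⟨e1, e2⟩ := Embed.xi_inv (c'.symm.trans c)
    exact .inl ⟨_, _, _, e1.symm, h1, h2.conv (e2.lift.app (.refl _)), rfl⟩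
  | all hτ c' h2 =>
    obtain ⟨e1, e2⟩ := Embed.xi_inv (c'.symm.trans c)
    exact .inr ⟨_, _, hτ, e1.symm, h2.conv (e2.lift.app (.refl _)), rfl⟩
  | memA c' h =>
    exact absurd ((c'.symm.trans c).head_eq (.app _ (.const _)) hne) (by simp [headOf, XiT])
  | lA b c' =>
    exact absurd ((c'.symm.trans c).head_eq (.app _ (.const _)) hne) (by simp [headOf, XiT, ICL.LT])
  | lH c' =>
    exact absurd ((c'.symm.trans c).head_eq (.app _ (.const _)) hne) (by simp [headOf, XiT, ICL.LT])
  | lK c' h =>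
    exact absurd ((c'.symm.trans c).head_eq (.app _ (.const _)) hne) (by simp [headOf, XiT, ICL.LT])

theorem Den.l_inv {T : TCtx B} {t s : Tm (SCon B Con)} {F : Env Con → Set (World B Con)}
    (h : Den T t F) (c : Conv t (.app (ICL.LT .L) s)) :
    (F = fun _ => Set.univ) ∧
      ((∃ τ, QTy τ ∧ Conv s (Atm τ)) ∨ ∃ p f, Conv s (Kt p) ∧ Den T p f) := by
  have hne : Ne (.app (ICL.LT .L) s : Tm (SCon B Con)) := .app _ (.const _)
  cases h with
  | atom c' h => exact (h.not_conv hne (by simp) rfl (c'.symm.trans c)).elim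
  | imp c' h1 h2 =>
    exact absurd ((c'.symm.trans c).head_eq (ne_xi _ _) hne) (by simp [headOf, XiT, ICL.LT])
  | all hτ c' h2 =>
    exact absurd ((c'.symm.trans c).head_eq (ne_xi _ _) hne) (by simp [headOf, XiT, ICL.LT])
  | memA c' h =>
    exact absurd ((c'.symm.trans c).head_eq (.app _ (.const _)) hne) (by simp [headOf, ICL.LT])
  | lA b c' =>
    exact ⟨rfl, .inl ⟨.base b, .inr ⟨b, rfl⟩,
      ((c.symm.trans c').app_inv (.const _) (.const _)).2⟩⟩
  | lH c' => exact ⟨rfl, .inl ⟨.o, .inl rfl, ((c.symm.trans c').app_inv (.const _) (.const _)).2⟩⟩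
  | lK c' h => exact ⟨rfl, .inr ⟨_, _, ((c.symm.trans c').app_inv (.const _) (.const _)).2, h⟩⟩

theorem Den.memA_inv {T : TCtx B} {t s : Tm (SCon B Con)} {b : B}
    {F : Env Con → Set (World B Con)} (h : Den T t F) (c : Conv t (.app (.const (.A b)) s)) :
    (F = fun _ => Set.univ) ∧ ∃ f, Val T (.base b) s f := by
  have hne : Ne (.app (.const (.A b)) s : Tm (SCon B Con)) := .app _ (.const _)
  cases h with
  | atom c' h => exact (h.not_conv hne (by simp) rfl (c'.symm.trans c)).elim
  | imp c' h1 h2 =>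
    exact absurd ((c'.symm.trans c).head_eq (ne_xi _ _) hne) (by simp [headOf, XiT])
  | all hτ c' h2 =>
    exact absurd ((c'.symm.trans c).head_eq (ne_xi _ _) hne) (by simp [headOf, XiT])
  | memA c' h =>
    obtain ⟨e1, e2⟩ := (c.symm.trans c').app_inv (.const _) (.const _)
    cases e1.const_inj
    exact ⟨rfl, _, _, e2, h⟩
  | lA b c' =>
    exact absurd ((c'.symm.trans c).head_eq (.app _ (.const _)) hne) (by simp [headOf, ICL.LT])
  | lH c' =>
    exact absurd ((c'.symm.trans c).head_eq (.app _ (.const _)) hne) (by simp [headOf, ICL.LT])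
  | lK c' h =>
    exact absurd ((c'.symm.trans c).head_eq (.app _ (.const _)) hne) (by simp [headOf, ICL.LT])

theorem Den.h_inv {T : TCtx B} {t s : Tm (SCon B Con)} {F : Env Con → Set (World B Con)}
    (h : Den T t F) (c : Conv t (.app (Hc .L) s)) :
    (F = fun _ => Set.univ) ∧ ∃ f, Den T s f := by
  obtain ⟨h1, h2⟩ := h.l_inv (c.trans (Conv.Hc_app _ _))
  refine ⟨h1, ?_⟩
  rcases h2 with ⟨τ, hτ, e⟩ | ⟨p, f, e, hp⟩
  · exact (not_Kt_Atm hτ e).elim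
  · exact ⟨f, hp.conv e.Kt_inv.symm⟩

theorem Den.mem_inv {T : TCtx B} {τ : Ty B} (hτ : QTy τ) {s : Tm (SCon B Con)}
    {F : Env Con → Set (World B Con)} (h : Den T (.app (Atm τ) s) F) : ∃ d, Val T τ s d := by
  rcases hτ with rfl | ⟨b, rfl⟩
  · exact (h.h_inv (.refl _)).2
  · exact (h.memA_inv (.refl _)).2

theorem Den.atom_inv {T : TCtx B} {t t' : Tm (SCon B Con)} {F : Env Con → Set (World B Con)}
    {f : Env Con → Dom Con .o} (h : Den T t F) (c : Conv t t') (h' : DenN T .o t' f) : F = f := by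
  cases h with
  | atom c' h =>
    cases h.unique h' (c'.symm.trans c)
    rfl
  | imp c' h1 h2 => exact (h'.not_conv (ne_xi _ _) (by simp) rfl (c.symm.trans c')).elim
  | all hτ c' h2 => exact (h'.not_conv (ne_xi _ _) (by simp) rfl (c.symm.trans c')).elim
  | memA c' h => exact (h'.not_conv (.app _ (.const _)) (by simp) rfl (c.symm.trans c')).elim
  | lA b c' => exact (h'.not_conv (.app _ (.const _)) (by simp) rfl (c.symm.trans c')).elim
  | lH c' => exact (h'.not_conv (.app _ (.const _)) (by simp) rfl (c.symm.trans c')).elim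
  | lK c' h => exact (h'.not_conv (.app _ (.const _)) (by simp) rfl (c.symm.trans c')).elim

theorem Den.unique {T : TCtx B} {t t' : Tm (SCon B Con)} {f f' : Env Con → Set (World B Con)}
    (h : Den T t f) (h' : Den T t' f') (c : Conv t' t) : f = f' := by
  induction h generalizing t' f' with
  | atom c' h => exact (h'.atom_inv (c.trans c') h).symm
  | imp c' _ _ ih1 ih2 =>
    rcases h'.xi_inv (c.trans c') with ⟨p, f, g, e, hf, hg, rfl⟩ | ⟨τ, g, hτ, e, -, -⟩
    · rw [ih1 hf e.symm.Kt_inv , ih2 hg (.refl _)]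
    · exact (not_Kt_Atm hτ e).elim
  | all hτ c' _ ih =>
    rcases h'.xi_inv (c.trans c') with ⟨p, f, g, e, hf, hg, rfl⟩ | ⟨τ, g, hτ', e, hg, rfl⟩
    · exact (not_Kt_Atm hτ e.symm).elim
    · cases Atm_inj hτ hτ' e
      rw [ih hg (.refl _)]
  | memA c' _ => exact (h'.memA_inv (c.trans c')).1.symm
  | lA b c' => exact (h'.l_inv (c.trans c')).1.symm
  | lH c' => exact (h'.l_inv (c.trans c')).1.symm
  | lK c' _ _ => exact (h'.l_inv (c.trans c')).1.symm

/-- The denotation `f` is given by substitution instances of a PRED2₀ term. -/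
def Definable (T : TCtx B) (τ : Ty B) (f : Env Con → Dom Con τ) : Prop :=
  ∃ a : Trm B Con τ, (∀ y ∈ FV a, T y.2 = some y.1) ∧ ∀ v, f (envOf v) = interp (substV v a)

theorem DenN.definable {T : TCtx B} {τ : Ty B} {t : Tm (SCon B Con)} {f : Env Con → Dom Con τ}
    (h : DenN T τ t f) : Definable T τ f := by
  induction h with
  | @var τ n h => exact ⟨.var τ n, by simpa [FV] using h, fun _ => rfl⟩
  | con c => exact ⟨.con c, by simp [FV], fun _ => rfl⟩
  | app _ _ ih1 ih2 =>
    obtain ⟨a, ha, ea⟩ := ih1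
    obtain ⟨b, hb, eb⟩ := ih2
    refine ⟨.app a b, fun y hy => ?_, fun v => ?_⟩
    · exact (Finset.mem_union.1 hy).elim (ha y) (hb y)
    · dsimp only
      rw [ea, eb]
      rfl

theorem definable_univ (T : TCtx B) : Definable (Con := Con) T .o fun _ => Set.univ := by
  have hq : QTy (.o : Ty B) := .inl rfl
  refine ⟨.all .o hq 0 (.imp (.var .o 0) (.var .o 0)), by simp [FV], fun v => ?_⟩
  change _ = Th _
  rw [Th_all]
  refine (Set.iInter_eq_univ.2 fun a => ?_).symm
  simp only [substV, Th_imp]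
  exact Set.eq_univ_of_forall fun w w' _ h => h

/-- The renaming which turns the de Bruijn variable `0` into the named variable `N`. -/
def lowerTo (N : Nat) : ∀ τ : Ty B, Nat → Trm B Con τ
  | τ, 0 => .var τ N
  | τ, n + 1 => .var τ n

theorem Definable.imp {T : TCtx B} {f g : Env Con → Set (World B Con)} (hf : Definable T .o f)
    (hg : Definable (tcons none T) .o g) :
    Definable T .o fun η => kimp (f η) (g (eskip η)) := by
  obtain ⟨a, ha, ea⟩ := hf
  obtain ⟨b, hb, eb⟩ := hg
  refine ⟨.imp a (substV (lowerTo 0) b), fun y hy => ?_, fun v => ?_⟩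
  · rcases Finset.mem_union.1 hy with hy | hy
    · exact ha y hy
    · rw [FV_substV] at hy
      obtain ⟨⟨τ, n⟩, hz, hy⟩ := Finset.mem_biUnion.1 hy
      have hz := hb _ hz
      cases n with
      | zero => cases hz
      | succ n =>
        obtain rfl := Finset.mem_singleton.1 hy
        exact hz
  · dsimp only
    rw [eskip_envOf, ea, eb]
    change _ = Th _
    simp only [substV, Th_imp]
    rw [substV_substV]
    congr 2
    refine substV_congr _ fun ⟨τ, n⟩ hz => ?_
    cases n with
    | zero => cases hb _ hz
    | succ n => rfl

theorem Definable.all {T : TCtx B} {τ : Ty B} (hτ : QTy τ) {g : Env Con → Set (World B Con)}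
    (hg : Definable (tcons (some τ) T) .o g) :
    Definable T .o fun η => ⋂ a : Trm B Con τ, g (econs (interp a) η) := by
  obtain ⟨b, hb, eb⟩ := hg
  obtain ⟨N, -, hN⟩ := exists_index_bound (Set.finite_empty (α := Trm B Con .o)) (FV b)
  refine ⟨.all τ hτ N (substV (lowerTo N) b), fun y hy => ?_, fun v => ?_⟩
  · simp only [FV, Finset.mem_erase, FV_substV, Finset.mem_biUnion] at hy
    obtain ⟨hy', ⟨τ', n⟩, hz, hy⟩ := hy
    have hz := hb _ hz
    cases n with
    | zero =>
      cases hz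
      exact (hy' (Finset.mem_singleton.1 hy)).elim
    | succ n =>
      obtain rfl := Finset.mem_singleton.1 hy
      exact hz
  · change _ = Th _
    rw [Th_all]
    refine Set.iInter_congr fun a => ?_
    rw [econs_envOf, eb, substV_substV]
    change Th _ = Th _
    congr 1
    refine substV_congr _ fun ⟨τ', n⟩ hz => ?_
    cases n with
    | zero =>
      cases hb _ hz
      change vcons a v τ' 0 = vupd v τ' N a τ' N
      rw [vcons_zero, vupd_same]
    | succ n =>
      refine (vupd_of_ne v a ?_).symm
      have := hN _ hz
      simp only [ne_eq, Prod.mk.injEq, not_and] at this ⊢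
      omega

theorem Den.definable {T : TCtx B} {t : Tm (SCon B Con)} {f : Env Con → Set (World B Con)}
    (h : Den T t f) : Definable T .o f := by
  induction h with
  | atom _ h => exact h.definable
  | imp _ _ _ ih1 ih2 => exact ih1.imp ih2
  | all hτ _ _ ih => exact ih.all hτ
  | memA | lA | lH | lK => exact definable_univ _

theorem Val.definable {T : TCtx B} {τ : Ty B} {t : Tm (SCon B Con)} {f : Env Con → Dom Con τ}
    (h : Val T τ t f) : Definable T τ f := by
  cases τ with
  | o => exact Den.definable h
  | base b =>
    obtain ⟨_, _, h⟩ := h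
    exact h.definable
  | arr b τ =>
    obtain ⟨_, _, h⟩ := h
    exact h.definable

theorem Den.mono {T : TCtx B} {t : Tm (SCon B Con)} {f : Env Con → Set (World B Con)}
    (h : Den T t f) {v : ∀ τ : Ty B, Nat → Trm B Con τ} {w w' : World B Con} (hw : w.1 ⊆ w'.1)
    (h' : w ∈ f (envOf v)) : w' ∈ f (envOf v) := by
  obtain ⟨a, -, e⟩ := h.definable
  rw [e] at h' ⊢
  exact Th_mono _ hw h'

theorem Den.h {T : TCtx B} {t : Tm (SCon B Con)} {f : Env Con → Set (World B Con)}
    (h : Den T t f) : Den (Con := Con) T (.app (Hc .L) t) fun _ => Set.univ :=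
  .lK (Conv.Hc_app _ _) h

theorem lam_lift_app {C : Type} (b : Tm C) : Conv (.app (Tm.lift (.lam b)) (.var 0)) b := by
  refine (Conv.beta _ _).trans (.of_eq ?_)
  rw [subst0_eq]
  change Tm.bind _ (b.rename (upr _)) = b
  rw [bind_rename]
  conv_rhs => rw [← bind_var b]
  congr 1
  funext n
  cases n <;> rfl

theorem Val.mem {T : TCtx B} {τ : Ty B} {s : Tm (SCon B Con)} {f : Env Con → Dom Con τ}
    (h : Val T τ s f) : Den T (.app (Atm τ) s) fun _ => Set.univ := by
  induction τ generalizing T s with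
  | o => exact Den.h h
  | base b =>
    obtain ⟨s', c, h⟩ := h
    exact .memA (.app (.refl _) c) h
  | arr b τ ih =>
    have h1 := ih ((h.lift (some (.base b))).app (Val.var (n := 0) rfl))
    have h3 := Den.all (.inr ⟨b, rfl⟩) (Atm_arr_app b τ s) (h1.conv (lam_lift_app _).symm)
    simpa only [Set.iInter_univ] using h3

/-- A world and a valuation satisfying a set of λ-terms. -/
def Sat (T : TCtx B) (σ : Nat → Tm (SCon B Con)) (Γ : Set (Tm (SCon B Con)))
    (v : ∀ τ : Ty B, Nat → Trm B Con τ) (w : World B Con) : Prop :=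
  ∀ g ∈ Γ, ∃ f, Den T (g.bind σ) f ∧ w ∈ f (envOf v)

/-- The substitution `σ` under a binder whose variable is named `x`. -/
def bindAt (x : Nat) (σ : Nat → Tm (SCon B Con)) : Nat → Tm (SCon B Con) :=
  fun n => if n = x then .var 0 else (σ n).lift

theorem bind_bindAt {B : Type} {Con : Ty B → Type} {x : Nat} {t : Tm (SCon B Con)} (hx : x ∉ t.fvar)
    (σ : Nat → Tm (SCon B Con)) : t.bind (bindAt x σ) = (t.bind σ).lift := by
  rw [lift, rename_bind]
  refine bind_congr fun n hn => ?_
  rw [bindAt, if_neg]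
  · rfl
  · rintro rfl
    exact hx hn

theorem app_bind_bindAt {B : Type} {Con : Ty B → Type} {x : Nat} {t : Tm (SCon B Con)}
    (hx : x ∉ t.fvar)
    (σ : Nat → Tm (SCon B Con)) :
    (Tm.app t (.var x)).bind (bindAt x σ) = .app (t.bind σ).lift (.var 0) := by
  simp [Tm.bind, bind_bindAt hx, bindAt]

theorem notMem_fvar_of_fvS {B : Type} {Con : Ty B → Type} {x : Nat} {Γ : Set (Tm (SCon B Con))}
    (hx : x ∉ fvS Γ)
    {g : Tm (SCon B Con)} (hg : g ∈ Γ) : x ∉ g.fvar :=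
  fun h => hx (Set.mem_biUnion hg h)

/-- The hypotheses of the premise of an introduction rule are meaningful. -/
theorem wf_insert {T : TCtx B} {σ : Nat → Tm (SCon B Con)} {Γ : Set (Tm (SCon B Con))} {x : Nat}
    {t : Tm (SCon B Con)} (hΓ : ∀ g ∈ Γ, ∃ f, Den T (g.bind σ) f) (hx : x ∉ fvS Γ)
    (hxt : x ∉ t.fvar) {o : Option (Ty B)}
    (ht : ∃ f, Den (tcons o T) (.app (t.bind σ).lift (.var 0)) f) :
    ∀ g ∈ insert (.app t (.var x)) Γ, ∃ f, Den (tcons o T) (g.bind (bindAt x σ)) f := by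
  rintro g (rfl | hg)
  · rwa [app_bind_bindAt hxt]
  · obtain ⟨f, hf⟩ := hΓ g hg
    rw [bind_bindAt (notMem_fvar_of_fvS hx hg)]
    exact ⟨_, hf.lift o⟩

theorem Sat.insert {T : TCtx B} {σ : Nat → Tm (SCon B Con)} {Γ : Set (Tm (SCon B Con))} {x : Nat}
    {t : Tm (SCon B Con)} {v v' : ∀ τ : Ty B, Nat → Trm B Con τ} {w : World B Con}
    (hΓ : Sat T σ Γ v w) (hv : etail (envOf v') = envOf v) (hx : x ∉ fvS Γ)
    (hxt : x ∉ t.fvar) {o : Option (Ty B)} {f : Env Con → Set (World B Con)}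
    (ht : Den (tcons o T) (.app (t.bind σ).lift (.var 0)) f) (hw : w ∈ f (envOf v')) :
    Sat (tcons o T) (bindAt x σ) (insert (.app t (.var x)) Γ) v' w := by
  rintro g (rfl | hg)
  · rw [app_bind_bindAt hxt]
    exact ⟨f, ht, hw⟩
  · obtain ⟨f, hf, hw⟩ := hΓ g hg
    rw [bind_bindAt (notMem_fvar_of_fvS hx hg)]
    exact ⟨_, hf.lift o, by rwa [hv]⟩

theorem Sat.mono {T : TCtx B} {σ : Nat → Tm (SCon B Con)} {Γ : Set (Tm (SCon B Con))}
    {v : ∀ τ : Ty B, Nat → Trm B Con τ} {w w' : World B Con} (hw : w.1 ⊆ w'.1)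
    (h : Sat T σ Γ v w) : Sat T σ Γ v w' := fun g hg =>
  let ⟨f, hf, h'⟩ := h g hg
  ⟨f, hf, hf.mono hw h'⟩

theorem Atm_lift_app_den {T : TCtx B} {τ : Ty B} {t : Tm (SCon B Con)} (h : Conv t (Atm τ)) :
    Den (Con := Con) (tcons (some τ) T) (.app t.lift (.var 0)) fun _ => Set.univ :=
  (Val.mem (Val.var (T := tcons (some τ) T) rfl)).conv
    ((h.lift.trans (Atm_rename τ _)).app (.refl _)).symm

theorem Kt_lift_app_den {T : TCtx B} {p t : Tm (SCon B Con)} {f : Env Con → Set (World B Con)}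
    (hp : Den T p f) (h : Conv t (Kt p)) :
    Den (tcons none T) (.app t.lift (.var 0)) fun η => f (etail η) :=
  (hp.lift none).conv ((h.lift.app (.refl _)).trans (lam_lift_app p.lift)).symm

/-- Every derivable λ-term denotes a proposition, which is true in the canonical model. -/
theorem soundness {Γ : Set (Tm (SCon B Con))} {t : Tm (SCon B Con)}
    (h : IDeriv (SCon.Xi : SCon B Con) SCon.L SCon.A false false Γ t) (T : TCtx B)
    (σ : Nat → Tm (SCon B Con)) (hΓ : ∀ g ∈ Γ, ∃ f, Den T (g.bind σ) f) :
    ∃ f, Den T (t.bind σ) f ∧ ∀ v w, Sat T σ Γ v w → w ∈ f (envOf v) := by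
  induction h generalizing T σ with
  | ax hg =>
    obtain ⟨f, hf⟩ := hΓ _ hg
    refine ⟨f, hf, fun v w hw => ?_⟩
    obtain ⟨f', hf', h⟩ := hw _ hg
    rwa [hf.unique hf' (.refl _)]
  | axLH => exact ⟨_, .lH (.refl _), fun _ _ _ => trivial⟩
  | axLA b => exact ⟨_, .lA b (.refl _), fun _ _ _ => trivial⟩
  | axDN h => cases h
  | eq _ c ih =>
    obtain ⟨f, hf, h⟩ := ih T σ hΓ
    exact ⟨f, hf.conv (c.bind σ), h⟩
  | hi _ ih =>
    obtain ⟨f, hf, h⟩ := ih T σ hΓ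
    exact ⟨_, hf.h, fun _ _ _ => trivial⟩
  | @xiE Γ t1 t2 t3 _ _ ih1 ih2 =>
    obtain ⟨F, hF, h1⟩ := ih1 T σ hΓ
    obtain ⟨f', hf', h2⟩ := ih2 T σ hΓ
    have key : ∀ (o : Option (Ty B)) (g : Env Con → Set (World B Con))
        (e : Env Con → Env Con), (∀ n τ, tcons o T n = some τ →
          Val T τ (scons (t3.bind σ) Tm.var n) fun η => e η n τ) →
        Den (tcons o T) (.app (t2.bind σ).lift (.var 0)) g →
        Den T ((Tm.app t2 t3).bind σ) fun η => g (e η) := fun o g e hs hg => by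
      have h := hg.bind hs
      rw [Tm.bind, lift_bind_scons, bind_var] at h
      exact h
    rcases hF.xi_inv (.refl _) with ⟨p, f, g, e, hf, hg, rfl⟩ | ⟨τ, g, hτ, e, hg, rfl⟩
    · refine ⟨_, key none g eskip ?_ hg, fun v w hw => ?_⟩
      · rintro (_ | n) τ hn
        · cases hn
        · exact Val.var hn
      · refine h1 v w hw w subset_rfl ?_
        rw [hf.unique hf' ((e.app (.refl _)).trans (Conv.Kt_app _ _))]
        exact h2 v w hw
    · obtain ⟨d, hd⟩ := (hf'.conv (e.app (.refl _))).mem_inv hτ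
      obtain ⟨a, -, ha⟩ := hd.definable
      refine ⟨_, key (some τ) g (fun η => econs (d η) η) ?_ hg, fun v w hw => ?_⟩
      · rintro (_ | n) τ hn
        · cases hn
          simp only [econs_zero]
          exact hd
        · exact Val.var hn
      · rw [ha]
        exact Set.mem_iInter.1 (h1 v w hw) _
  | @xiI Γ t1 t2 x _ _ hxΓ hx1 hx2 ih1 ih2 =>
    obtain ⟨F, hF, -⟩ := ih2 T σ hΓ
    rcases (hF.l_inv (.refl _)).2 with ⟨τ, hτ, e⟩ | ⟨p, f, e, hp⟩
    · have hm := Atm_lift_app_den (T := T) e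
      obtain ⟨g, hg, h⟩ := ih1 (tcons (some τ) T) (bindAt x σ) (wf_insert hΓ hxΓ hx1 ⟨_, hm⟩)
      rw [app_bind_bindAt hx2] at hg
      refine ⟨_, .all hτ (Conv.app (Conv.app (.refl _) e) (.refl _)) hg, fun v w hw => ?_⟩
      refine Set.mem_iInter.2 fun a => ?_
      rw [econs_envOf]
      exact h _ w (hw.insert rfl hxΓ hx1 hm trivial)
    · have hm := Kt_lift_app_den hp e
      obtain ⟨g, hg, h⟩ := ih1 (tcons none T) (bindAt x σ) (wf_insert hΓ hxΓ hx1 ⟨_, hm⟩)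
      rw [app_bind_bindAt hx2] at hg
      refine ⟨_, .imp (Conv.app (Conv.app (.refl _) e) (.refl _)) hp hg,
        fun v w hw w' hww' hw' => ?_⟩
      rw [eskip_envOf]
      exact h _ w' ((hw.mono hww').insert rfl hxΓ hx1 hm hw')
  | @xiH Γ t1 t2 x _ _ hxΓ hx1 hx2 ih1 ih2 =>
    obtain ⟨F, hF, -⟩ := ih2 T σ hΓ
    rcases (hF.l_inv (.refl _)).2 with ⟨τ, hτ, e⟩ | ⟨p, f, e, hp⟩
    · have hm := Atm_lift_app_den (T := T) e
      obtain ⟨g, hg, -⟩ := ih1 (tcons (some τ) T) (bindAt x σ) (wf_insert hΓ hxΓ hx1 ⟨_, hm⟩)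
      obtain ⟨g, hg⟩ := (hg.h_inv (.refl _)).2
      rw [app_bind_bindAt hx2] at hg
      exact ⟨_, Den.h (.all hτ (Conv.app (Conv.app (.refl _) e) (.refl _)) hg),
        fun _ _ _ => trivial⟩
    · have hm := Kt_lift_app_den hp e
      obtain ⟨g, hg, -⟩ := ih1 (tcons none T) (bindAt x σ) (wf_insert hΓ hxΓ hx1 ⟨_, hm⟩)
      obtain ⟨g, hg⟩ := (hg.h_inv (.refl _)).2
      rw [app_bind_bindAt hx2] at hg
      exact ⟨_, Den.h (.imp (Conv.app (Conv.app (.refl _) e) (.refl _)) hp hg),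
        fun _ _ _ => trivial⟩
  | fL _ h => cases h

theorem val_tr {τ : Ty B} (a : Trm B Con τ) {T : TCtx B} {e : Ty B × Nat → Nat}
    (he : ∀ y, T (e y) = some y.1) :
    ∃ f, Val T τ (tr e a) f ∧
      ∀ v, f (envOf v) = interp (substV (fun τ n => v τ (e (τ, n))) a) := by
  induction a generalizing T e with
  | var τ n => exact ⟨_, Val.var (he (τ, n)), fun v => rfl⟩
  | con c => exact ⟨_, (DenN.con c).val (.refl _), fun v => rfl⟩
  | app t s ih1 ih2 =>
    obtain ⟨f, hf, ef⟩ := ih1 he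
    obtain ⟨g, hg, eg⟩ := ih2 he
    refine ⟨_, hf.app hg, fun v => ?_⟩
    rw [ef, eg]
    rfl
  | imp φ ψ ih1 ih2 =>
    obtain ⟨f, hf, ef⟩ := ih1 he
    obtain ⟨g, hg, eg⟩ := ih2 he
    refine ⟨_, Den.imp (Conv.impTm_eq _ _ _) hf (Kt_lift_app_den hg (.refl _)), fun v => ?_⟩
    change kimp (f (envOf v)) (g (envOf v)) = Th _
    rw [ef, eg, substV, Th_imp]
    rfl
  | all τ hτ m φ ih =>
    obtain ⟨g, hg, eg⟩ := ih (T := tcons (some τ) T)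
      (e := fun y => if y = (τ, m) then 0 else e y + 1) fun y => by
        split_ifs with h
        · rw [h]
          rfl
        · exact he y
    refine ⟨_, Den.all hτ (.refl _) (Den.conv hg (lam_lift_app _).symm), fun v => ?_⟩
    change _ = Th _
    rw [Th_all]
    refine Set.iInter_congr fun a => ?_
    rw [econs_envOf, eg]
    change Th _ = Th _
    congr 1
    refine substV_congr _ fun y _ => ?_
    by_cases hy : y = (τ, m)
    · subst hy
      simp only [vupd_same, if_true, vcons_zero]
    · rw [vupd_of_ne _ _ hy]
      simp only [Prod.mk.eta, if_neg hy]
      rfl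

end Embed

namespace Embed

open ICL PRED2

variable {B : Type} [DecidableEq B] {Con : PRED2.Ty B → Type}

/-- **Completeness of the embedding of PRED2₀ into I₀ (Theorem 5.21).**
If `⟦Δ⟧ ∪ Γ(Δ ∪ {φ}) ⊢ ⟦φ⟧` in `I₀` then `Δ ⊢ φ` in PRED2₀.
(`env` is an injective assignment of illative variables to PRED2₀ variables, and
`yc` chooses, for each base type, a variable fresh for `Δ ∪ {φ}`.) -/
theorem embedding_complete {B : Type} [DecidableEq B] [Finite B]
    {Con : PRED2.Ty B → Type} [∀ τ : PRED2.Ty B, Countable (Con τ)]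
    (env : PRED2.Ty B × Nat → Nat) (henv : Function.Injective env)
    (Δ : Set (Trm B Con .o)) (φ : Trm B Con .o)
    (yc : B → Nat) (hyc : ∀ b : B, ∀ ψ ∈ insert φ Δ, (PRED2.Ty.base b, yc b) ∉ FV ψ)
    (hd : IDerivFrom (((fun ψ : Trm B Con .o => tr env ψ) '' Δ) ∪ GammaSet env (insert φ Δ) yc)
      (tr env φ)) :
    DerivFrom Δ φ := by
  have : Nonempty (Ty B × Nat) := ⟨(.o, 0)⟩
  obtain ⟨Γ, hΓ, hfin, h⟩ := hd
  let T : TCtx B := fun k => some (Function.invFun env k).1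
  let v : ∀ τ : Ty B, Nat → Trm B Con τ := fun τ k => .var τ (Function.invFun env k).2
  have hinv : ∀ y, Function.invFun env (env y) = y := Function.leftInverse_invFun henv
  have hT : ∀ y, T (env y) = some y.1 := fun y => by simp only [T, hinv]
  have hv : (fun τ n => v τ (env (τ, n))) = vid := by
    funext τ n
    simp only [v, hinv, vid]
  have htr : ∀ ψ : Trm B Con .o, ∃ f, Den T (tr env ψ) f ∧ f (envOf v) = Th (norm ψ) :=
    fun ψ => by
      obtain ⟨f, hf, e⟩ := val_tr ψ hT
      exact ⟨f, hf, by rw [e, hv]; rfl⟩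
  have hden : ∀ g ∈ Γ, (∃ ψ ∈ Δ, tr env ψ = g) ∨ Den T g fun _ => Set.univ := fun g hg => by
    rcases hΓ hg with hg | ((⟨τ, x, -, rfl⟩ | ⟨τ, c, rfl⟩) | ⟨b, rfl⟩) | ⟨b, rfl⟩
    · exact .inl hg
    · exact .inr (Val.var (hT (τ, x))).mem
    · exact .inr ((DenN.con c).val (.refl _)).mem
    · exact .inr (.lA b (.refl _))
    · exact .inr (Val.var (hT (.base b, yc b))).mem
  obtain ⟨Δ', hΔ', hfin', hcov⟩ : ∃ Δ' ⊆ Δ, Δ'.Finite ∧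
      Γ ∩ ((fun ψ : Trm B Con .o => tr env ψ) '' Δ) ⊆ (fun ψ => tr env ψ) '' Δ' := by
    obtain ⟨Δ', h1, h2, h3⟩ := Set.exists_subset_image_finite_and.1
      ⟨_, Set.inter_subset_right, hfin.inter_of_left ((fun ψ : Trm B Con .o => tr env ψ) '' Δ),
        subset_rfl⟩
    exact ⟨Δ', h1, h2, h3⟩
  obtain ⟨f, hf, hsound⟩ := soundness h T .var fun g hg => by
    rw [Tm.bind_var]
    rcases hden g hg with ⟨ψ, -, rfl⟩ | h
    · exact (htr ψ).imp fun _ h => h.1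
    · exact ⟨_, h⟩
  obtain ⟨f', hf', e⟩ := htr φ
  rw [Tm.bind_var] at hf
  have hφ : (⟨Δ', hfin'⟩ : World B Con) ∈ f (envOf v) := by
    refine hsound v _ fun g hg => ?_
    rw [Tm.bind_var]
    rcases hden g hg with ⟨ψ, hψ, rfl⟩ | h
    · obtain ⟨ψ', hψ', e⟩ := hcov ⟨hg, Set.mem_image_of_mem _ hψ⟩
      obtain ⟨f, hf, ef⟩ := htr ψ'
      refine ⟨f, e ▸ hf, ?_⟩
      rw [ef]
      exact (Deriv.ax hψ').norm_intro hfin'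
    · exact ⟨_, h, trivial⟩
  rw [hf.unique hf' (.refl _), e] at hφ
  exact ⟨Δ', hΔ', hfin', Deriv.norm_elim hfin' hφ⟩

end Embed
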